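/- arXiv:2408.07863 — 3 statements merged into one kernel-verified Lean document; each statement's English description precedes it below -/
import Mathlib

section
/- For every n ≥ 1, the map 𝒯 is a bijection from the set 𝒫_n of 1/2/3-puzzles on Δ_n to the set 𝒯_{3,n} of interlacing triangular arrays of rank 3 and height n, and for each boundary condition λ = (λ^{(1)},λ^{(2)},λ^{(3)}) ∈ ({1,2,3}^n)³ it restricts to a bijection from the puzzles with boundary conditions λ to the arrays with top row λ (i.e., the top row of T^{(i)} equals λ^{(i)} for i = 1,2,3). -/
/-- Twice the horizontal coordinate `h(i,j,k) = i*n + j - (n+k)/2` of an entry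
`T^(i)_(j,k)` of a triangular array of height `n` (doubled to stay in `ℤ`). -/
def Hc (n i j k : ℕ) : ℤ :=
  2 * ((i : ℤ) * (n : ℤ) + (j : ℤ)) - ((n : ℤ) + (k : ℤ))

/-- `T` is an interlacing triangular array of rank `m` and height `n`:
entries `T i j k ∈ {1,…,m}` for `1 ≤ i ≤ m`, `1 ≤ j ≤ k ≤ n`;
(a) each value `a ∈ {1,…,m}` occurs exactly `k` times in row `k`;
(b) any two equal entries of row `k` have an interlacing equal entry in row `k-1`
strictly between them in horizontal coordinate. -/
def IsITA (m n : ℕ) (T : ℕ → ℕ → ℕ → ℕ) : Prop :=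
  (∀ i j k, 1 ≤ i → i ≤ m → 1 ≤ j → j ≤ k → k ≤ n → T i j k ∈ Finset.Icc 1 m) ∧
  (∀ k, 1 ≤ k → k ≤ n → ∀ a ∈ Finset.Icc 1 m,
      ((Finset.Icc 1 m ×ˢ Finset.Icc 1 k).filter (fun p => T p.1 p.2 k = a)).card = k) ∧
  (∀ k, 1 ≤ k → k ≤ n → ∀ i j i' j',
      1 ≤ i → i ≤ m → 1 ≤ j → j ≤ k → 1 ≤ i' → i' ≤ m → 1 ≤ j' → j' ≤ k →
      T i j k = T i' j' k → Hc n i j k < Hc n i' j' k →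
      ∃ i'' j'', 1 ≤ i'' ∧ i'' ≤ m ∧ 1 ≤ j'' ∧ j'' ≤ k - 1 ∧
        T i'' j'' (k - 1) = T i j k ∧
        Hc n i j k < Hc n i'' j'' (k - 1) ∧ Hc n i'' j'' (k - 1) < Hc n i' j' k)

/-- The set of interlacing triangular arrays of rank `m` and height `n`,
normalized to be `0` outside the support `1 ≤ i ≤ m`, `1 ≤ j ≤ k ≤ n`. -/
def ITAFull (m n : ℕ) : Set (ℕ → ℕ → ℕ → ℕ) :=
  {T | IsITA m n T ∧ ∀ i j k, ¬(1 ≤ i ∧ i ≤ m ∧ 1 ≤ j ∧ j ≤ k ∧ k ≤ n) → T i j k = 0}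

/-- Edges of the triangular grid `Δ_n`: an edge is encoded as `(d, x, y)` with
`x + y < n`, where `d = 0` is the horizontal edge `{(x,y),(x+1,y)}`,
`d = 1` is the vertical edge `{(x,y),(x,y+1)}` (parallel to the left side), and
`d = 2` is the diagonal edge `{(x+1,y),(x,y+1)}` (parallel to the right side).
A `1/2/3`-puzzle is an edge labeling by `{1,2,3}` such that the three edges of
each upward face (`P 1 x y`, `P 2 x y`, `P 0 x y`) and of each downward face
(`P 2 x y`, `P 0 x (y+1)`, `P 1 (x+1) y`) get pairwise distinct labels. -/
def IsPuzzle123 (n : ℕ) (P : ℕ → ℕ → ℕ → ℕ) : Prop :=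
  (∀ d x y, d < 3 → x + y < n → P d x y ∈ Finset.Icc 1 3) ∧
  (∀ x y, x + y < n →
      P 1 x y ≠ P 2 x y ∧ P 1 x y ≠ P 0 x y ∧ P 2 x y ≠ P 0 x y) ∧
  (∀ x y, x + y + 1 < n →
      P 2 x y ≠ P 0 x (y + 1) ∧ P 2 x y ≠ P 1 (x + 1) y ∧ P 0 x (y + 1) ≠ P 1 (x + 1) y)

/-- The set of `1/2/3`-puzzles on `Δ_n`, normalized to `0` off the edge set. -/
def PuzzleFull (n : ℕ) : Set (ℕ → ℕ → ℕ → ℕ) :=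
  {P | IsPuzzle123 n P ∧ ∀ d x y, ¬(d < 3 ∧ x + y < n) → P d x y = 0}

/-- The map `𝒯` from `1/2/3`-puzzles on `Δ_n` to triangular arrays: the `k`-th row
reads the boundary of the copy of `Δ_k` inside `Δ_n` clockwise from the base point:
the left side bottom to top (`T^(1)`), the right side top to bottom (`T^(2)`),
the bottom side right to left (`T^(3)`). -/
def TofP (n : ℕ) (P : ℕ → ℕ → ℕ → ℕ) : ℕ → ℕ → ℕ → ℕ :=
  fun i j k =>
    if 1 ≤ j ∧ j ≤ k ∧ k ≤ n then
      if i = 1 then P 1 0 (j - 1)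
      else if i = 2 then P 2 (j - 1) (k - j)
      else if i = 3 then P 0 (k - j) 0
      else 0
    else 0

/-- Number of entries equal to `a` in row `k` up to position `(i,j)` (lexicographically). -/
def SS (T : ℕ → ℕ → ℕ → ℕ) (k a i j : ℕ) : ℕ :=
  ((Finset.Icc 1 3 ×ˢ Finset.Icc 1 k).filter
    (fun p => T p.1 p.2 k = a ∧ (p.1 < i ∨ (p.1 = i ∧ p.2 ≤ j)))).card

lemma SS_start (T : ℕ → ℕ → ℕ → ℕ) (k a : ℕ) : SS T k a 1 0 = 0 := by
  unfold SS
  rw [Finset.card_eq_zero, Finset.filter_eq_empty_iff]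
  rintro ⟨i, j⟩ h
  simp only [Finset.mem_product, Finset.mem_Icc] at h ⊢
  omega

lemma SS_row0 (T : ℕ → ℕ → ℕ → ℕ) (a i j : ℕ) : SS T 0 a i j = 0 := by
  simp [SS]

lemma SS_next (T : ℕ → ℕ → ℕ → ℕ) (k a i : ℕ) : SS T k a (i + 1) 0 = SS T k a i k := by
  unfold SS
  congr 1
  apply Finset.filter_congr
  rintro ⟨i', j'⟩ h
  simp only [Finset.mem_product, Finset.mem_Icc] at h ⊢
  have : (i' < i + 1 ∨ i' = i + 1 ∧ j' ≤ 0) ↔ (i' < i ∨ i' = i ∧ j' ≤ k) := by omega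
  rw [this]

lemma SS_full (T : ℕ → ℕ → ℕ → ℕ) (k a : ℕ) : SS T k a 3 k =
    ((Finset.Icc 1 3 ×ˢ Finset.Icc 1 k).filter (fun p => T p.1 p.2 k = a)).card := by
  unfold SS
  congr 1
  apply Finset.filter_congr
  rintro ⟨i', j'⟩ h
  simp only [Finset.mem_product, Finset.mem_Icc] at h ⊢
  have : (i' < 3 ∨ i' = 3 ∧ j' ≤ k) := by omega
  simp [this]

lemma SS_succ (T : ℕ → ℕ → ℕ → ℕ) (k a i j : ℕ) (h1 : 1 ≤ i) (h3 : i ≤ 3) (hj : j + 1 ≤ k) :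
    SS T k a i (j + 1) = SS T k a i j + if T i (j + 1) k = a then 1 else 0 := by
  unfold SS
  split_ifs with hT
  · rw [← Finset.card_insert_of_notMem (a := (i, j + 1))]
    · congr 1
      ext ⟨i', j'⟩
      simp only [Finset.mem_filter, Finset.mem_insert, Finset.mem_product, Finset.mem_Icc,
        Prod.mk.injEq]
      constructor
      · rintro ⟨h, ha, hl⟩
        by_cases e : i' = i ∧ j' = j + 1
        · exact Or.inl e
        · exact Or.inr ⟨h, ha, by omega⟩
      · rintro (⟨rfl, rfl⟩ | ⟨h, ha, hl⟩)
        · exact ⟨by omega, hT, by omega⟩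
        · exact ⟨h, ha, by omega⟩
    · simp
  · rw [add_zero]
    congr 1
    apply Finset.filter_congr
    rintro ⟨i', j'⟩ h
    simp only
    constructor
    · rintro ⟨ha, hl⟩
      refine ⟨ha, ?_⟩
      by_contra hc
      have e : i' = i ∧ j' = j + 1 := by omega
      obtain ⟨rfl, rfl⟩ := e
      exact hT ha
    · rintro ⟨ha, hl⟩
      exact ⟨ha, by omega⟩

lemma SS_mono (T : ℕ → ℕ → ℕ → ℕ) (k a i j i' j' : ℕ) (h : i < i' ∨ (i = i' ∧ j ≤ j')) :
    SS T k a i j ≤ SS T k a i' j' := by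
  unfold SS
  apply Finset.card_le_card
  intro p hp
  simp only [Finset.mem_filter] at hp ⊢
  exact ⟨hp.1, hp.2.1, by omega⟩

lemma SS_exists (T : ℕ → ℕ → ℕ → ℕ) (k a i j i' j' : ℕ)
    (h : SS T k a i j < SS T k a i' j') :
    ∃ i'' j'', 1 ≤ i'' ∧ i'' ≤ 3 ∧ 1 ≤ j'' ∧ j'' ≤ k ∧ T i'' j'' k = a ∧
      (i < i'' ∨ (i = i'' ∧ j < j'')) ∧ (i'' < i' ∨ (i'' = i' ∧ j'' ≤ j')) := by
  unfold SS at h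
  obtain ⟨⟨p, q⟩, hp, hq⟩ := Finset.exists_mem_notMem_of_card_lt_card h
  simp only [Finset.mem_filter, Finset.mem_product, Finset.mem_Icc] at hp hq
  refine ⟨p, q, hp.1.1.1, hp.1.1.2, hp.1.2.1, hp.1.2.2, hp.2.1, ?_, hp.2.2⟩
  by_contra hc
  exact hq ⟨hp.1, hp.2.1, by omega⟩

/-- Interlacing of rows `K` and `K+1` in letter `a`, in terms of prefix counts. -/
def RowQ (T : ℕ → ℕ → ℕ → ℕ) (K a : ℕ) : Prop :=
  (∀ i j, 1 ≤ i → i ≤ 3 → j ≤ K → SS T K a i j ≤ SS T (K + 1) a i j) ∧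
  (∀ i j, 1 ≤ i → i ≤ 3 → j ≤ K → SS T (K + 1) a i (j + 1) ≤ SS T K a i j + 1)

lemma Hc_lt_same (n k i j i' j' : ℕ) (h1 : 1 ≤ i) (h3 : i ≤ 3) (h1' : 1 ≤ i') (h3' : i' ≤ 3)
    (hk : k ≤ n) (hj : 1 ≤ j) (hjk : j ≤ k) (hj' : 1 ≤ j') (hjk' : j' ≤ k) :
    Hc n i j k < Hc n i' j' k ↔ (i < i' ∨ (i = i' ∧ j < j')) := by
  unfold Hc
  have e : i = 1 ∨ i = 2 ∨ i = 3 := by omega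
  have e' : i' = 1 ∨ i' = 2 ∨ i' = 3 := by omega
  rcases e with rfl | rfl | rfl <;> rcases e' with rfl | rfl | rfl <;>
    omega

lemma Hc_lt_up (n K i j i' j' : ℕ) (h1 : 1 ≤ i) (h3 : i ≤ 3) (h1' : 1 ≤ i') (h3' : i' ≤ 3)
    (hk : K + 1 ≤ n) (hj : 1 ≤ j) (hjk : j ≤ K + 1) (hj' : 1 ≤ j') (hjk' : j' ≤ K) :
    Hc n i j (K + 1) < Hc n i' j' K ↔ (i < i' ∨ (i = i' ∧ j ≤ j')) := by
  unfold Hc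
  have e : i = 1 ∨ i = 2 ∨ i = 3 := by omega
  have e' : i' = 1 ∨ i' = 2 ∨ i' = 3 := by omega
  rcases e with rfl | rfl | rfl <;> rcases e' with rfl | rfl | rfl <;>
    omega

lemma Hc_lt_down (n K i j i' j' : ℕ) (h1 : 1 ≤ i) (h3 : i ≤ 3) (h1' : 1 ≤ i') (h3' : i' ≤ 3)
    (hk : K + 1 ≤ n) (hj : 1 ≤ j) (hjk : j ≤ K) (hj' : 1 ≤ j') (hjk' : j' ≤ K + 1) :
    Hc n i j K < Hc n i' j' (K + 1) ↔ (i < i' ∨ (i = i' ∧ j < j')) := by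
  unfold Hc
  have e : i = 1 ∨ i = 2 ∨ i = 3 := by omega
  have e' : i' = 1 ∨ i' = 2 ∨ i' = 3 := by omega
  rcases e with rfl | rfl | rfl <;> rcases e' with rfl | rfl | rfl <;>
    omega

/-- Condition (b) for row `K+1`. -/
def RowB (n : ℕ) (T : ℕ → ℕ → ℕ → ℕ) (K : ℕ) : Prop :=
  ∀ i j i' j',
      1 ≤ i → i ≤ 3 → 1 ≤ j → j ≤ K + 1 → 1 ≤ i' → i' ≤ 3 → 1 ≤ j' → j' ≤ K + 1 →
      T i j (K + 1) = T i' j' (K + 1) → Hc n i j (K + 1) < Hc n i' j' (K + 1) →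
      ∃ i'' j'', 1 ≤ i'' ∧ i'' ≤ 3 ∧ 1 ≤ j'' ∧ j'' ≤ K ∧
        T i'' j'' K = T i j (K + 1) ∧
        Hc n i j (K + 1) < Hc n i'' j'' K ∧ Hc n i'' j'' K < Hc n i' j' (K + 1)

lemma rowB_of_rowQ (n : ℕ) (T : ℕ → ℕ → ℕ → ℕ) (K : ℕ) (hK : K + 1 ≤ n)
    (hT : ∀ i j, 1 ≤ i → i ≤ 3 → 1 ≤ j → j ≤ K + 1 → T i j (K + 1) ∈ Finset.Icc 1 3)
    (h : ∀ a ∈ Finset.Icc 1 3, RowQ T K a) : RowB n T K := by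
  intro i j i' j' h1 h3 hj hjk h1' h3' hj' hjk' he hl
  rw [Hc_lt_same n _ _ _ _ _ h1 h3 h1' h3' hK hj hjk hj' hjk'] at hl
  obtain ⟨qa, qb⟩ := h _ (hT i j h1 h3 hj hjk)
  obtain ⟨j, rfl⟩ : ∃ l, j = l + 1 := ⟨j - 1, by omega⟩
  obtain ⟨j', rfl⟩ : ∃ l, j' = l + 1 := ⟨j' - 1, by omega⟩
  have e1 := SS_succ T (K + 1) (T i (j + 1) (K + 1)) i j h1 h3 hjk
  have e2 := SS_succ T (K + 1) (T i (j + 1) (K + 1)) i' j' h1' h3' hjk'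
  rw [if_pos rfl] at e1
  rw [if_pos he.symm] at e2
  have e3 := SS_mono T (K + 1) (T i (j + 1) (K + 1)) i (j + 1) i' j' (by omega)
  have e4 := qa i j h1 h3 (by omega)
  have e5 := qb i' j' h1' h3' (by omega)
  obtain ⟨p, q, a1, a2, a3, a4, a5, a6, a7⟩ :=
    SS_exists T K (T i (j + 1) (K + 1)) i j i' j' (by omega)
  refine ⟨p, q, a1, a2, a3, a4, a5, ?_, ?_⟩
  · rw [Hc_lt_up n K _ _ _ _ h1 h3 a1 a2 hK hj hjk a3 a4]; omega
  · rw [Hc_lt_down n K _ _ _ _ a1 a2 h1' h3' hK a3 a4 hj' hjk']; omega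

lemma inter_card (n K : ℕ) (T : ℕ → ℕ → ℕ → ℕ) (hK : K + 1 ≤ n) (hb : RowB n T K) (a : ℕ)
    (pA pB : ℕ × ℕ → Prop) [DecidablePred pA] [DecidablePred pB]
    (hAB : ∀ i j i' j' i'' j'', 1 ≤ i → i ≤ 3 → 1 ≤ j → j ≤ K + 1 → 1 ≤ i' → i' ≤ 3 →
      1 ≤ j' → j' ≤ K + 1 → 1 ≤ i'' → i'' ≤ 3 → 1 ≤ j'' → j'' ≤ K → pA (i, j) → pA (i', j') →
      (i < i'' ∨ (i = i'' ∧ j ≤ j'')) → (i'' < i' ∨ (i'' = i' ∧ j'' < j')) → pB (i'', j'')) :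
    ((Finset.Icc 1 3 ×ˢ Finset.Icc 1 (K + 1)).filter
      (fun p => T p.1 p.2 (K + 1) = a ∧ pA p)).card ≤
    ((Finset.Icc 1 3 ×ˢ Finset.Icc 1 K).filter
      (fun p => T p.1 p.2 K = a ∧ pB p)).card + 1 := by
  have hA : Set.InjOn (fun p : ℕ × ℕ => Hc n p.1 p.2 (K + 1))
      ((Finset.Icc 1 3 ×ˢ Finset.Icc 1 (K + 1)).filter
      (fun p => T p.1 p.2 (K + 1) = a ∧ pA p) : Finset (ℕ × ℕ)) := by
    rintro ⟨i, j⟩ hp ⟨i', j'⟩ hq heq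
    simp only [Finset.coe_filter, Set.mem_ofPred_eq, Finset.mem_product, Finset.mem_Icc] at hp hq
    have x1 := Hc_lt_same n (K + 1) i j i' j' (by omega) (by omega) (by omega) (by omega)
      hK (by omega) (by omega) (by omega) (by omega)
    have x2 := Hc_lt_same n (K + 1) i' j' i j (by omega) (by omega) (by omega) (by omega)
      hK (by omega) (by omega) (by omega) (by omega)
    simp only at heq
    rw [heq] at x1 x2
    simp only [lt_irrefl, false_iff] at x1 x2
    simp only [Prod.mk.injEq]
    omega
  rw [← Finset.card_image_of_injOn hA]
  refine le_trans (Finset.card_le_of_interleaved (t := Finset.image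
    (fun p : ℕ × ℕ => Hc n p.1 p.2 K) ((Finset.Icc 1 3 ×ˢ Finset.Icc 1 K).filter
      (fun p => T p.1 p.2 K = a ∧ pB p))) ?_) (Nat.add_le_add_right Finset.card_image_le 1)
  intro x hx y hy hxy _
  simp only [Finset.mem_image, Finset.mem_filter, Finset.mem_product, Finset.mem_Icc,
    Prod.exists] at hx hy
  obtain ⟨i, j, ⟨⟨⟨h1, h3⟩, hj, hjk⟩, ha, hpa⟩, rfl⟩ := hx
  obtain ⟨i', j', ⟨⟨⟨h1', h3'⟩, hj', hjk'⟩, ha', hpa'⟩, rfl⟩ := hy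
  obtain ⟨p, q, a1, a2, a3, a4, a5, a6, a7⟩ :=
    hb i j i' j' h1 h3 hj hjk h1' h3' hj' hjk' (ha.trans ha'.symm) hxy
  refine ⟨_, Finset.mem_image.2 ⟨(p, q), ?_, rfl⟩, a6, a7⟩
  rw [Hc_lt_up n K _ _ _ _ h1 h3 a1 a2 hK hj hjk a3 a4] at a6
  rw [Hc_lt_down n K _ _ _ _ a1 a2 h1' h3' hK a3 a4 hj' hjk'] at a7
  simp only [Finset.mem_filter, Finset.mem_product, Finset.mem_Icc]
  exact ⟨⟨⟨a1, a2⟩, a3, a4⟩, a5.trans ha, hAB i j i' j' p q h1 h3 hj hjk h1' h3' hj' hjk'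
    a1 a2 a3 a4 hpa hpa' a6 a7⟩

lemma SS_compl (T : ℕ → ℕ → ℕ → ℕ) (k a i j : ℕ) : SS T k a i j +
    ((Finset.Icc 1 3 ×ˢ Finset.Icc 1 k).filter
    (fun p => T p.1 p.2 k = a ∧ ¬ (p.1 < i ∨ (p.1 = i ∧ p.2 ≤ j)))).card = SS T k a 3 k := by
  rw [SS_full]
  unfold SS
  rw [← Finset.filter_filter, ← Finset.filter_filter]
  exact Finset.card_filter_add_card_filter_not _

lemma rowQ_of_rowB (n : ℕ) (T : ℕ → ℕ → ℕ → ℕ) (K a : ℕ) (hK : K + 1 ≤ n)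
    (h0 : SS T K a 3 K = K) (h1 : SS T (K + 1) a 3 (K + 1) = K + 1)
    (h : RowB n T K) : RowQ T K a := by
  constructor
  · intro i j hi hi3 hj
    have e1 := SS_compl T K a i j
    have e2 := SS_compl T (K + 1) a i j
    have e3 := inter_card n K T hK h a (fun p => ¬ (p.1 < i ∨ (p.1 = i ∧ p.2 ≤ j)))
      (fun p => ¬ (p.1 < i ∨ (p.1 = i ∧ p.2 ≤ j))) (by intros; simp only at *; omega)
    omega
  · intro i j hi hi3 hj
    exact inter_card n K T hK h a _ _ (by intros; simp only at *; omega)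

lemma core_count (s m h m' s' a : ℕ) (hs : s ∈ Finset.Icc 1 3) (hm : m ∈ Finset.Icc 1 3)
    (hh : h ∈ Finset.Icc 1 3) (hm' : m' ∈ Finset.Icc 1 3) (hs' : s' ∈ Finset.Icc 1 3)
    (h1 : s ≠ m) (h2 : s ≠ h) (h3 : m ≠ h) (h4 : m' ≠ h) (h5 : m' ≠ s') (h6 : h ≠ s') :
    ((if s = a then 1 else 0) + (if m = a then 1 else 0) : ℕ) =
      (if m' = a then 1 else 0) + (if s' = a then 1 else 0) := by
  simp only [Finset.mem_Icc] at *
  have : (m' = s ∧ s' = m) ∨ (m' = m ∧ s' = s) := by omega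
  rcases this with ⟨rfl, rfl⟩ | ⟨rfl, rfl⟩ <;> omega

lemma core_three (s m h a : ℕ) (hs : s ∈ Finset.Icc 1 3) (hm : m ∈ Finset.Icc 1 3)
    (hh : h ∈ Finset.Icc 1 3) (ha : a ∈ Finset.Icc 1 3)
    (h1 : s ≠ m) (h2 : s ≠ h) (h3 : m ≠ h) :
    ((if s = a then 1 else 0) + (if m = a then 1 else 0) + (if h = a then 1 else 0) : ℕ) = 1 := by
  simp only [Finset.mem_Icc] at *
  split_ifs <;> omega

lemma TofP_one (n : ℕ) (P : ℕ → ℕ → ℕ → ℕ) (j k : ℕ) (h : j + 1 ≤ k) (hk : k ≤ n) :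
    TofP n P 1 (j + 1) k = P 1 0 j := by
  simp [TofP, h, hk]

lemma TofP_two (n : ℕ) (P : ℕ → ℕ → ℕ → ℕ) (j k : ℕ) (h : j + 1 ≤ k) (hk : k ≤ n) :
    TofP n P 2 (j + 1) k = P 2 j (k - (j + 1)) := by
  simp [TofP, h, hk]

lemma TofP_three (n : ℕ) (P : ℕ → ℕ → ℕ → ℕ) (j k : ℕ) (h : j + 1 ≤ k) (hk : k ≤ n) :
    TofP n P 3 (j + 1) k = P 0 (k - (j + 1)) 0 := by
  simp [TofP, h, hk]

lemma ite_le_one' (p : Prop) [Decidable p] : (if p then 1 else 0 : ℕ) ≤ 1 := by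
  split_ifs <;> omega

lemma puzzle_rowQ (n : ℕ) (P : ℕ → ℕ → ℕ → ℕ) (hP : IsPuzzle123 n P) (K : ℕ) (hK : K + 1 ≤ n)
    (a : ℕ) (ha : a ∈ Finset.Icc 1 3) :
    RowQ (TofP n P) K a ∧
      SS (TofP n P) (K + 1) a 3 (K + 1) = SS (TofP n P) K a 3 K + 1 := by
  obtain ⟨hr, hu, hd⟩ := hP
  have E1 : ∀ j, j ≤ K → SS (TofP n P) (K + 1) a 1 j = SS (TofP n P) K a 1 j := by
    intro j
    induction j with
    | zero => intro _; rw [SS_start, SS_start]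
    | succ j ih =>
      intro hj
      rw [SS_succ _ _ _ _ _ (by omega) (by omega) (by omega),
        SS_succ _ _ _ _ _ (by omega) (by omega) (by omega), ih (by omega),
        TofP_one _ _ _ _ (by omega) (by omega), TofP_one _ _ _ _ (by omega) (by omega)]
  have E2 : ∀ j, j ≤ K → SS (TofP n P) (K + 1) a 2 j =
      SS (TofP n P) K a 2 j + if P 1 j (K - j) = a then 1 else 0 := by
    intro j
    induction j with
    | zero =>
      intro _
      rw [SS_next, SS_next, SS_succ _ _ _ _ _ (by omega) (by omega) (by omega), E1 K le_rfl,
        TofP_one _ _ _ _ (by omega) (by omega), Nat.sub_zero]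
    | succ j ih =>
      intro hj
      rw [SS_succ _ _ _ _ _ (by omega) (by omega) (by omega),
        SS_succ _ _ _ _ _ (by omega) (by omega) (by omega), ih (by omega),
        TofP_two _ _ _ _ (by omega) (by omega), TofP_two _ _ _ _ (by omega) (by omega)]
      obtain ⟨y, rfl⟩ : ∃ y, K = j + 1 + y := ⟨K - (j + 1), by omega⟩
      have e1 : j + 1 + y - j = y + 1 := by omega
      have e2 : j + 1 + y + 1 - (j + 1) = y + 1 := by omega
      have e3 : j + 1 + y - (j + 1) = y := by omega
      rw [e1, e2, e3]
      have c := core_count (P 1 j (y + 1)) (P 2 j (y + 1)) (P 0 j (y + 1)) (P 2 j y)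
        (P 1 (j + 1) y) a (hr _ _ _ (by omega) (by omega)) (hr _ _ _ (by omega) (by omega))
        (hr _ _ _ (by omega) (by omega)) (hr _ _ _ (by omega) (by omega))
        (hr _ _ _ (by omega) (by omega))
        (hu j (y + 1) (by omega)).1 (hu j (y + 1) (by omega)).2.1 (hu j (y + 1) (by omega)).2.2
        (hd j y (by omega)).1 (hd j y (by omega)).2.1 (hd j y (by omega)).2.2
      omega
  have E3 : ∀ j, j ≤ K → SS (TofP n P) (K + 1) a 3 (j + 1) = SS (TofP n P) K a 3 j + 1 := by
    intro j
    induction j with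
    | zero =>
      intro _
      rw [SS_succ _ _ _ _ _ (by omega) (by omega) (by omega), SS_next _ _ _ 2, SS_next _ _ _ 2,
        SS_succ _ _ _ _ _ (by omega) (by omega) (by omega), E2 K le_rfl,
        TofP_two _ _ _ _ (by omega) (by omega), TofP_three _ _ _ _ (by omega) (by omega)]
      have e1 : K + 1 - (K + 1) = 0 := by omega
      have e2 : K + 1 - (0 + 1) = K := by omega
      rw [e1, e2, Nat.sub_self]
      have c := core_three (P 1 K 0) (P 2 K 0) (P 0 K 0) a
        (hr _ _ _ (by omega) (by omega)) (hr _ _ _ (by omega) (by omega))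
        (hr _ _ _ (by omega) (by omega)) ha
        (hu K 0 (by omega)).1 (hu K 0 (by omega)).2.1 (hu K 0 (by omega)).2.2
      omega
    | succ j ih =>
      intro hj
      rw [SS_succ _ _ _ _ (j + 1) (by omega) (by omega) (by omega),
        SS_succ _ K _ _ _ (by omega) (by omega) (by omega), ih (by omega),
        TofP_three _ _ _ _ (by omega) (by omega), TofP_three _ _ _ _ (by omega) (by omega)]
      have e : K + 1 - (j + 1 + 1) = K - (j + 1) := by omega
      rw [e]
      omega
  refine ⟨⟨?_, ?_⟩, E3 K le_rfl⟩
  · intro i j h1 h3 hj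
    have e : i = 1 ∨ i = 2 ∨ i = 3 := by omega
    rcases e with rfl | rfl | rfl
    · exact (E1 j hj).ge
    · rw [E2 j hj]; omega
    · have x1 := E3 j hj
      rw [SS_succ _ _ _ _ _ (by omega) (by omega) (by omega)] at x1
      have := ite_le_one' (TofP n P 3 (j + 1) (K + 1) = a)
      omega
  · intro i j h1 h3 hj
    have e : i = 1 ∨ i = 2 ∨ i = 3 := by omega
    rcases e with rfl | rfl | rfl
    · rw [SS_succ _ _ _ _ _ (by omega) (by omega) (by omega), E1 j hj]
      have := ite_le_one' (TofP n P 1 (j + 1) (K + 1) = a)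
      omega
    · rw [SS_succ _ _ _ _ _ (by omega) (by omega) (by omega), E2 j hj,
        TofP_two _ _ _ _ (by omega) (by omega)]
      have e : K + 1 - (j + 1) = K - j := by omega
      rw [e]
      have := (hu j (K - j) (by omega)).1
      split_ifs <;> omega
    · exact (E3 j hj).le

lemma mapsTo_aux (n : ℕ) (P : ℕ → ℕ → ℕ → ℕ) (hP : P ∈ PuzzleFull n) :
    TofP n P ∈ ITAFull 3 n := by
  obtain ⟨hp, -⟩ := hP
  have hrange : ∀ i j k, 1 ≤ i → i ≤ 3 → 1 ≤ j → j ≤ k → k ≤ n →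
      TofP n P i j k ∈ Finset.Icc 1 3 := by
    intro i j k h1 h3 hj hjk hk
    obtain ⟨j, rfl⟩ : ∃ l, j = l + 1 := ⟨j - 1, by omega⟩
    have e : i = 1 ∨ i = 2 ∨ i = 3 := by omega
    rcases e with rfl | rfl | rfl
    · rw [TofP_one _ _ _ _ hjk hk]; exact hp.1 _ _ _ (by omega) (by omega)
    · rw [TofP_two _ _ _ _ hjk hk]; exact hp.1 _ _ _ (by omega) (by omega)
    · rw [TofP_three _ _ _ _ hjk hk]; exact hp.1 _ _ _ (by omega) (by omega)
  refine ⟨⟨hrange, ?_, ?_⟩, ?_⟩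
  · intro k _ hk a ha
    rw [← SS_full]
    clear * - hk ha hp
    induction k with
    | zero => exact SS_row0 _ _ _ _
    | succ k ih => rw [(puzzle_rowQ n P hp k hk a ha).2, ih (by omega)]
  · intro k hk1 hk
    obtain ⟨K, rfl⟩ : ∃ l, k = l + 1 := ⟨k - 1, by omega⟩
    have := rowB_of_rowQ n (TofP n P) K hk (fun i j a b c d => hrange i j _ a b c d hk)
      (fun a ha => (puzzle_rowQ n P hp K hk a ha).1)
    exact this
  · intro i j k h
    unfold TofP
    split_ifs <;> omega

lemma injOn_aux (n : ℕ) (P P' : ℕ → ℕ → ℕ → ℕ) (hP : P ∈ PuzzleFull n) (hP' : P' ∈ PuzzleFull n)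
    (h : TofP n P = TofP n P') : P = P' := by
  obtain ⟨⟨hr, hu, hd⟩, hz⟩ := hP
  obtain ⟨⟨hr', hu', hd'⟩, hz'⟩ := hP'
  simp only [Finset.mem_Icc] at hr hr'
  have h2 : ∀ x y, x + y < n → P 2 x y = P' 2 x y := by
    intro x y hxy
    have e := congrFun (congrFun (congrFun h 2) (x + 1)) (x + y + 1)
    rw [TofP_two _ _ _ _ (by omega) (by omega), TofP_two _ _ _ _ (by omega) (by omega)] at e
    have e1 : x + y + 1 - (x + 1) = y := by omega
    rwa [e1] at e
  have h0 : ∀ x y, x + y < n → P 1 x y = P' 1 x y → P 0 x y = P' 0 x y := by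
    intro x y hxy e
    have a := h2 x y hxy
    have := hu x y hxy
    have := hu' x y hxy
    have := hr 0 x y (by omega) hxy
    have := hr 1 x y (by omega) hxy
    have := hr 2 x y (by omega) hxy
    have := hr' 0 x y (by omega) hxy
    omega
  have h1 : ∀ x y, x + y < n → P 1 x y = P' 1 x y := by
    intro x
    induction x with
    | zero =>
      intro y hxy
      have e := congrFun (congrFun (congrFun h 1) (y + 1)) (y + 1)
      rwa [TofP_one _ _ _ _ (by omega) (by omega), TofP_one _ _ _ _ (by omega) (by omega)] at e
    | succ x ih =>
      intro y hxy
      have a := h0 x (y + 1) (by omega) (ih _ (by omega))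
      have b := h2 x y (by omega)
      have := hd x y (by omega)
      have := hd' x y (by omega)
      have := hr 0 x (y + 1) (by omega) (by omega)
      have := hr 2 x y (by omega) (by omega)
      have := hr 1 (x + 1) y (by omega) (by omega)
      have := hr' 1 (x + 1) y (by omega) (by omega)
      omega
  funext d x y
  by_cases hc : d < 3 ∧ x + y < n
  · obtain ⟨hd3, hxy⟩ := hc
    have e : d = 0 ∨ d = 1 ∨ d = 2 := by omega
    rcases e with rfl | rfl | rfl
    · exact h0 x y hxy (h1 x y hxy)
    · exact h1 x y hxy
    · exact h2 x y hxy
  · rw [hz _ _ _ hc, hz' _ _ _ hc]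

/-- Reconstructed labels of the edges parallel to the left side. -/
def VV (T : ℕ → ℕ → ℕ → ℕ) : ℕ → ℕ → ℕ
  | 0, y => T 1 (y + 1) (y + 1)
  | x + 1, y => VV T x (y + 1) + T 2 (x + 1) (x + y + 2) - T 2 (x + 1) (x + y + 1)

section Rows
variable (T : ℕ → ℕ → ℕ → ℕ) (K : ℕ)

lemma F1 (hT' : ∀ i j, 1 ≤ i → i ≤ 3 → 1 ≤ j → j ≤ K → T i j K ∈ Finset.Icc 1 3)
    (hQ : ∀ a ∈ Finset.Icc 1 3, RowQ T K a) :
    ∀ j, j ≤ K → ((∀ a ∈ Finset.Icc 1 3, SS T (K + 1) a 1 j = SS T K a 1 j) ∧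
      (j + 1 ≤ K → T 1 (j + 1) (K + 1) = T 1 (j + 1) K)) := by
  have key : ∀ j, j + 1 ≤ K → (∀ a ∈ Finset.Icc 1 3, SS T (K + 1) a 1 j = SS T K a 1 j) →
      T 1 (j + 1) (K + 1) = T 1 (j + 1) K := by
    intro j hj h
    have hm := hT' 1 (j + 1) (by omega) (by omega) (by omega) hj
    have q := (hQ _ hm).1 1 (j + 1) (by omega) (by omega) hj
    rw [SS_succ _ _ _ _ _ (by omega) (by omega) (by omega),
      SS_succ _ _ _ _ _ (by omega) (by omega) (by omega), h _ hm, if_pos rfl] at q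
    by_contra hc
    rw [if_neg hc] at q
    omega
  intro j
  induction j with
  | zero =>
    intro _
    have : (∀ a ∈ Finset.Icc 1 3, SS T (K + 1) a 1 0 = SS T K a 1 0) := by
      intro a _
      rw [SS_start, SS_start]
    exact ⟨this, fun h => key 0 h this⟩
  | succ j ih =>
    intro hj
    have i1 := (ih (by omega)).1
    have i2 := (ih (by omega)).2 hj
    have : (∀ a ∈ Finset.Icc 1 3, SS T (K + 1) a 1 (j + 1) = SS T K a 1 (j + 1)) := by
      intro a ha
      rw [SS_succ _ _ _ _ _ (by omega) (by omega) (by omega),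
        SS_succ _ _ _ _ _ (by omega) (by omega) (by omega), i1 a ha, i2]
    exact ⟨this, fun h => key _ h this⟩

lemma core_swap (s m m' : ℕ) (hs : s ∈ Finset.Icc 1 3) (hm : m ∈ Finset.Icc 1 3)
    (hm' : m' ∈ Finset.Icc 1 3)
    (h : (if m' = m' then 1 else 0 : ℕ) ≤ (if s = m' then 1 else 0) + (if m = m' then 1 else 0)) :
    (m' = s ∧ s + m - m' = m) ∨ (m' = m ∧ s + m - m' = s) := by
  simp only [Finset.mem_Icc] at *
  split_ifs at h <;> omega

lemma F2 (hT' : ∀ i j, 1 ≤ i → i ≤ 3 → 1 ≤ j → j ≤ K → T i j K ∈ Finset.Icc 1 3)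
    (hT : ∀ i j, 1 ≤ i → i ≤ 3 → 1 ≤ j → j ≤ K + 1 → T i j (K + 1) ∈ Finset.Icc 1 3)
    (hQ : ∀ a ∈ Finset.Icc 1 3, RowQ T K a) :
    ∀ j, j ≤ K → (VV T j (K - j) ∈ Finset.Icc 1 3 ∧
      (∀ a ∈ Finset.Icc 1 3, SS T (K + 1) a 2 j =
        SS T K a 2 j + if VV T j (K - j) = a then 1 else 0) ∧
      VV T j (K - j) ≠ T 2 (j + 1) (K + 1) ∧
      (j + 1 ≤ K → ((T 2 (j + 1) K = VV T j (K - j) ∧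
          VV T (j + 1) (K - (j + 1)) = T 2 (j + 1) (K + 1)) ∨
        (T 2 (j + 1) K = T 2 (j + 1) (K + 1) ∧
          VV T (j + 1) (K - (j + 1)) = VV T j (K - j))))) := by
  have key : ∀ j, j ≤ K → VV T j (K - j) ∈ Finset.Icc 1 3 →
      (∀ a ∈ Finset.Icc 1 3, SS T (K + 1) a 2 j =
        SS T K a 2 j + if VV T j (K - j) = a then 1 else 0) →
      VV T j (K - j) ≠ T 2 (j + 1) (K + 1) ∧
      (j + 1 ≤ K → ((T 2 (j + 1) K = VV T j (K - j) ∧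
          VV T (j + 1) (K - (j + 1)) = T 2 (j + 1) (K + 1)) ∨
        (T 2 (j + 1) K = T 2 (j + 1) (K + 1) ∧
          VV T (j + 1) (K - (j + 1)) = VV T j (K - j)))) := by
    intro j hj hV hS
    have hm := hT 2 (j + 1) (by omega) (by omega) (by omega) (by omega)
    constructor
    · intro hc
      have q := (hQ _ hm).2 2 j (by omega) (by omega) hj
      rw [SS_succ _ _ _ _ _ (by omega) (by omega) (by omega), hS _ hm, if_pos hc,
        if_pos rfl] at q
      omega
    · intro hj1
      have hm' := hT' 2 (j + 1) (by omega) (by omega) (by omega) hj1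
      have q := (hQ _ hm').1 2 (j + 1) (by omega) (by omega) hj1
      rw [SS_succ _ _ _ _ _ (by omega) (by omega) (by omega),
        SS_succ _ _ _ _ _ (by omega) (by omega) (by omega), hS _ hm'] at q
      have c := core_swap _ _ _ hV hm hm' (by omega)
      have e : VV T (j + 1) (K - (j + 1)) =
          VV T j (K - j) + T 2 (j + 1) (K + 1) - T 2 (j + 1) K := by
        obtain ⟨y, rfl⟩ : ∃ y, K = j + 1 + y := ⟨K - (j + 1), by omega⟩
        have e1 : j + 1 + y - j = y + 1 := by omega
        have e3 : j + 1 + y - (j + 1) = y := by omega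
        have e4 : j + 1 + y + 1 = j + y + 2 := by omega
        have e5 : j + 1 + y = j + y + 1 := by omega
        rw [e1, e3, e4, e5, VV]
      rw [e]
      exact c
  intro j
  induction j with
  | zero =>
    intro _
    have v : VV T 0 (K - 0) ∈ Finset.Icc 1 3 := by
      rw [VV]; exact hT _ _ (by omega) (by omega) (by omega) (by omega)
    have s : (∀ a ∈ Finset.Icc 1 3, SS T (K + 1) a 2 0 =
        SS T K a 2 0 + if VV T 0 (K - 0) = a then 1 else 0) := by
      intro a ha
      rw [SS_next, SS_next, SS_succ _ _ _ _ _ (by omega) (by omega) (by omega),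
        (F1 T K hT' hQ K le_rfl).1 a ha, VV, Nat.sub_zero]
    exact ⟨v, s, key 0 (by omega) v s⟩
  | succ j ih =>
    intro hj
    obtain ⟨v, s, d, c⟩ := ih (by omega)
    have c := c hj
    have hm := hT 2 (j + 1) (by omega) (by omega) (by omega) (by omega)
    have v' : VV T (j + 1) (K - (j + 1)) ∈ Finset.Icc 1 3 := by
      rcases c with c | c
      · rw [c.2]; exact hm
      · rw [c.2]; exact v
    have s' : (∀ a ∈ Finset.Icc 1 3, SS T (K + 1) a 2 (j + 1) =
        SS T K a 2 (j + 1) + if VV T (j + 1) (K - (j + 1)) = a then 1 else 0) := by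
      intro a ha
      rw [SS_succ _ _ _ _ _ (by omega) (by omega) (by omega),
        SS_succ _ _ _ _ _ (by omega) (by omega) (by omega), s a ha]
      rcases c with c | c
      · rw [c.1, c.2]
      · rw [c.1, c.2]; omega
    exact ⟨v', s', key _ hj v' s'⟩

lemma F3 (hT' : ∀ i j, 1 ≤ i → i ≤ 3 → 1 ≤ j → j ≤ K → T i j K ∈ Finset.Icc 1 3)
    (hT : ∀ i j, 1 ≤ i → i ≤ 3 → 1 ≤ j → j ≤ K + 1 → T i j (K + 1) ∈ Finset.Icc 1 3)
    (hQ : ∀ a ∈ Finset.Icc 1 3, RowQ T K a) :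
    VV T K 0 ≠ T 3 1 (K + 1) ∧ T 2 (K + 1) (K + 1) ≠ T 3 1 (K + 1) ∧
    ∀ a ∈ Finset.Icc 1 3, SS T (K + 1) a 3 1 = SS T K a 3 0 + 1 := by
  obtain ⟨v, s, d, -⟩ := F2 T K hT' hT hQ K le_rfl
  rw [Nat.sub_self] at v s d
  have e : ∀ a ∈ Finset.Icc 1 3, SS T (K + 1) a 3 1 = SS T K a 3 0 +
      ((if VV T K 0 = a then 1 else 0) + (if T 2 (K + 1) (K + 1) = a then 1 else 0) +
      (if T 3 1 (K + 1) = a then 1 else 0)) := by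
    intro a ha
    have := SS_succ T (K + 1) a 3 0 (by omega) (by omega) (by omega)
    rw [zero_add] at this
    rw [this, SS_next _ _ _ 2, SS_next _ _ _ 2,
      SS_succ _ _ _ _ _ (by omega) (by omega) (by omega), s a ha]
    omega
  have hq := hT 3 1 (by omega) (by omega) (by omega) (by omega)
  have q := (hQ _ hq).2 3 0 (by omega) (by omega) (by omega)
  rw [zero_add, e _ hq, if_pos rfl] at q
  have n1 : VV T K 0 ≠ T 3 1 (K + 1) := by
    intro hc; rw [if_pos hc] at q; omega
  have n2 : T 2 (K + 1) (K + 1) ≠ T 3 1 (K + 1) := by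
    intro hc; rw [if_pos hc] at q; omega
  refine ⟨n1, n2, fun a ha => ?_⟩
  rw [e a ha, core_three _ _ _ _ v (hT _ _ (by omega) (by omega) (by omega) (by omega)) hq ha
    d n1 n2]

lemma F4 (hT' : ∀ i j, 1 ≤ i → i ≤ 3 → 1 ≤ j → j ≤ K → T i j K ∈ Finset.Icc 1 3)
    (hT : ∀ i j, 1 ≤ i → i ≤ 3 → 1 ≤ j → j ≤ K + 1 → T i j (K + 1) ∈ Finset.Icc 1 3)
    (hQ : ∀ a ∈ Finset.Icc 1 3, RowQ T K a) :
    ∀ j, j ≤ K → ((∀ a ∈ Finset.Icc 1 3, SS T (K + 1) a 3 (j + 1) = SS T K a 3 j + 1) ∧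
      (j + 1 ≤ K → T 3 (j + 1 + 1) (K + 1) = T 3 (j + 1) K)) := by
  have key : ∀ j, j + 1 ≤ K →
      (∀ a ∈ Finset.Icc 1 3, SS T (K + 1) a 3 (j + 1) = SS T K a 3 j + 1) →
      T 3 (j + 1 + 1) (K + 1) = T 3 (j + 1) K := by
    intro j hj h
    have hm := hT 3 (j + 1 + 1) (by omega) (by omega) (by omega) (by omega)
    have q := (hQ _ hm).2 3 (j + 1) (by omega) (by omega) hj
    rw [SS_succ _ _ _ _ (j + 1) (by omega) (by omega) (by omega), h _ hm,
      SS_succ _ _ _ _ _ (by omega) (by omega) (by omega), if_pos rfl] at q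
    by_contra hc
    rw [if_neg (fun e => hc e.symm)] at q
    omega
  intro j
  induction j with
  | zero =>
    intro _
    have := (F3 T K hT' hT hQ).2.2
    exact ⟨this, fun h => key 0 h this⟩
  | succ j ih =>
    intro hj
    have i1 := (ih (by omega)).1
    have i2 := (ih (by omega)).2 hj
    have : (∀ a ∈ Finset.Icc 1 3, SS T (K + 1) a 3 (j + 1 + 1) = SS T K a 3 (j + 1) + 1) := by
      intro a ha
      rw [SS_succ _ _ _ _ (j + 1) (by omega) (by omega) (by omega),
        SS_succ _ K _ _ _ (by omega) (by omega) (by omega), i1 a ha, i2]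
      omega
    exact ⟨this, fun h => key _ h this⟩

end Rows

/-- The inverse map. -/
def PofT (n : ℕ) (T : ℕ → ℕ → ℕ → ℕ) : ℕ → ℕ → ℕ → ℕ := fun d x y =>
  if d < 3 ∧ x + y < n then
    (if d = 1 then VV T x y else if d = 2 then T 2 (x + 1) (x + y + 1)
      else 6 - VV T x y - T 2 (x + 1) (x + y + 1))
  else 0

lemma surjOn_aux (n : ℕ) (T : ℕ → ℕ → ℕ → ℕ) (hT : T ∈ ITAFull 3 n) :
    PofT n T ∈ PuzzleFull n ∧ TofP n (PofT n T) = T := by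
  obtain ⟨⟨hr, hc, hb⟩, hz⟩ := hT
  have hcount : ∀ k, k ≤ n → ∀ a ∈ Finset.Icc 1 3, SS T k a 3 k = k := by
    intro k hk a ha
    rcases Nat.eq_zero_or_pos k with rfl | h
    · exact SS_row0 _ _ _ _
    · rw [SS_full]; exact hc k h hk a ha
  have hQ : ∀ K, K + 1 ≤ n → ∀ a ∈ Finset.Icc 1 3, RowQ T K a := by
    intro K hK a ha
    exact rowQ_of_rowB n T K a hK (hcount K (by omega) a ha) (hcount _ hK a ha)
      (hb (K + 1) (by omega) hK)
  have hrow : ∀ K, K ≤ n → ∀ i j, 1 ≤ i → i ≤ 3 → 1 ≤ j → j ≤ K → T i j K ∈ Finset.Icc 1 3 :=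
    fun K hK i j a b c d => hr i j K a b c d hK
  have f1 := fun K (hK : K + 1 ≤ n) => F1 T K (hrow K (by omega)) (hQ K hK)
  have f2 := fun K (hK : K + 1 ≤ n) => F2 T K (hrow K (by omega)) (hrow _ hK) (hQ K hK)
  have f3 := fun K (hK : K + 1 ≤ n) => F3 T K (hrow K (by omega)) (hrow _ hK) (hQ K hK)
  have f4 := fun K (hK : K + 1 ≤ n) => F4 T K (hrow K (by omega)) (hrow _ hK) (hQ K hK)
  have p0 : ∀ x y, x + y < n → PofT n T 0 x y = 6 - VV T x y - T 2 (x + 1) (x + y + 1) := by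
    intro x y h; simp [PofT, h]
  have p1 : ∀ x y, x + y < n → PofT n T 1 x y = VV T x y := by
    intro x y h; simp [PofT, h]
  have p2 : ∀ x y, x + y < n → PofT n T 2 x y = T 2 (x + 1) (x + y + 1) := by
    intro x y h; simp [PofT, h]
  have hV : ∀ x y, x + y < n → VV T x y ∈ Finset.Icc 1 3 ∧ VV T x y ≠ T 2 (x + 1) (x + y + 1) := by
    intro x y h
    have := f2 (x + y) (by omega) x (by omega)
    rw [Nat.add_sub_cancel_left] at this
    exact ⟨this.1, this.2.2.1⟩
  have hM : ∀ x y, x + y < n → T 2 (x + 1) (x + y + 1) ∈ Finset.Icc 1 3 := by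
    intro x y h
    exact hr _ _ _ (by omega) (by omega) (by omega) (by omega) (by omega)
  have hD : ∀ x y, x + y + 1 < n →
      ((T 2 (x + 1) (x + y + 1) = VV T x (y + 1) ∧
          VV T (x + 1) y = T 2 (x + 1) (x + y + 1 + 1)) ∨
        (T 2 (x + 1) (x + y + 1) = T 2 (x + 1) (x + y + 1 + 1) ∧
          VV T (x + 1) y = VV T x (y + 1))) := by
    intro x y h
    have := (f2 (x + y + 1) (by omega) x (by omega)).2.2.2 (by omega)
    have e1 : x + y + 1 - x = y + 1 := by omega
    have e2 : x + y + 1 - (x + 1) = y := by omega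
    rwa [e1, e2] at this
  simp only [Finset.mem_Icc] at hV hM
  refine ⟨⟨⟨?_, ?_, ?_⟩, ?_⟩, ?_⟩
  · intro d x y hd h
    have a := hV x y h
    have b := hM x y h
    rw [Finset.mem_Icc]
    have e : d = 0 ∨ d = 1 ∨ d = 2 := by omega
    rcases e with rfl | rfl | rfl
    · rw [p0 x y h]; omega
    · rw [p1 x y h]; omega
    · rw [p2 x y h]; omega
  · intro x y h
    have a := hV x y h
    have b := hM x y h
    rw [p0 x y h, p1 x y h, p2 x y h]
    omega
  · intro x y h
    have a := hV x (y + 1) (by omega)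
    have b := hM x (y + 1) (by omega)
    have c := hD x y h
    rw [p0 x (y + 1) (by omega), p1 (x + 1) y (by omega), p2 x y (by omega)]
    have e : x + (y + 1) + 1 = x + y + 1 + 1 := by omega
    rw [e] at a b ⊢
    omega
  · intro d x y h
    simp [PofT, h]
  · have g1 : ∀ d j, j + 1 + d ≤ n → T 1 (j + 1) (j + 1 + d) = T 1 (j + 1) (j + 1) := by
      intro d j
      induction d with
      | zero => intro _; rfl
      | succ d ih =>
        intro h
        rw [← ih (by omega)]
        exact (f1 (j + 1 + d) (by omega) j (by omega)).2 (by omega)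
    have g3 : ∀ j d, j + 1 + d ≤ n → T 3 (j + 1) (j + 1 + d) = T 3 1 (d + 1) := by
      intro j d
      induction j with
      | zero => intro _; rw [zero_add, add_comm 1 d]
      | succ j ih =>
        intro h
        rw [← ih (by omega)]
        have := (f4 (j + 1 + d) (by omega) j (by omega)).2 (by omega)
        rw [← this]
        congr 1
        omega
    funext i j k
    by_cases hs : 1 ≤ i ∧ i ≤ 3 ∧ 1 ≤ j ∧ j ≤ k ∧ k ≤ n
    · obtain ⟨h1, h3, hj, hjk, hk⟩ := hs
      obtain ⟨j, rfl⟩ : ∃ l, j = l + 1 := ⟨j - 1, by omega⟩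
      obtain ⟨d, rfl⟩ : ∃ l, k = j + 1 + l := ⟨k - (j + 1), by omega⟩
      have e : i = 1 ∨ i = 2 ∨ i = 3 := by omega
      rcases e with rfl | rfl | rfl
      · rw [TofP_one _ _ _ _ hjk hk, p1 _ _ (by omega), VV, g1 d j hk]
      · rw [TofP_two _ _ _ _ hjk hk, Nat.add_sub_cancel_left, p2 _ _ (by omega)]
        congr 1
        omega
      · rw [TofP_three _ _ _ _ hjk hk, Nat.add_sub_cancel_left, p0 _ _ (by omega), g3 j d hk]
        have a := hV d 0 (by omega)
        have b := hM d 0 (by omega)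
        have c := f3 d (by omega)
        have r := hr 3 1 (d + 1) (by omega) (by omega) (by omega) (by omega) (by omega)
        rw [Finset.mem_Icc] at r
        simp only [add_zero] at *
        omega
    · rw [hz i j k hs]
      unfold TofP
      split_ifs <;> omega

/-- `𝒯` is a bijection from `1/2/3`-puzzles on `Δ_n` to interlacing triangular arrays
of rank `3` and height `n`, and for each boundary condition
`λ = (λ^(1), λ^(2), λ^(3)) ∈ ({1,2,3}^n)^3` it restricts to a bijection from puzzles
with boundary conditions `λ` to arrays with top row `λ`. -/
theorem TofP_bijection (n : ℕ) (hn : 1 ≤ n) :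
    Set.BijOn (TofP n) (PuzzleFull n) (ITAFull 3 n) ∧
    ∀ lam : ℕ → ℕ → ℕ,
      (∀ i j, 1 ≤ i → i ≤ 3 → 1 ≤ j → j ≤ n → lam i j ∈ Finset.Icc 1 3) →
      Set.BijOn (TofP n)
        {P | P ∈ PuzzleFull n ∧ ∀ j, 1 ≤ j → j ≤ n →
            P 1 0 (j - 1) = lam 1 j ∧ P 2 (j - 1) (n - j) = lam 2 j ∧
            P 0 (n - j) 0 = lam 3 j}
        {T | T ∈ ITAFull 3 n ∧ ∀ i j, 1 ≤ i → i ≤ 3 → 1 ≤ j → j ≤ n →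
            T i j n = lam i j} := by
  have main : Set.BijOn (TofP n) (PuzzleFull n) (ITAFull 3 n) :=
    ⟨fun P hP => mapsTo_aux n P hP, fun P hP P' hP' h => injOn_aux n P P' hP hP' h,
      fun T hT => ⟨PofT n T, surjOn_aux n T hT⟩⟩
  refine ⟨main, fun lam _ => ?_⟩
  have key : ∀ P : ℕ → ℕ → ℕ → ℕ, (∀ j, 1 ≤ j → j ≤ n →
            P 1 0 (j - 1) = lam 1 j ∧ P 2 (j - 1) (n - j) = lam 2 j ∧
            P 0 (n - j) 0 = lam 3 j) ↔ (∀ i j, 1 ≤ i → i ≤ 3 → 1 ≤ j → j ≤ n →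
            TofP n P i j n = lam i j) := by
    intro P
    constructor
    · intro h i j h1 h3 hj hjn
      have := h j hj hjn
      have e : i = 1 ∨ i = 2 ∨ i = 3 := by omega
      rcases e with rfl | rfl | rfl <;> simp [TofP, hj, hjn, this]
    · intro h j hj hjn
      have a := h 1 j (by omega) (by omega) hj hjn
      have b := h 2 j (by omega) (by omega) hj hjn
      have c := h 3 j (by omega) (by omega) hj hjn
      simp [TofP, hj, hjn] at a b c
      exact ⟨a, b, c⟩
  refine ⟨?_, ?_, ?_⟩
  · rintro P ⟨hP, hl⟩
    exact ⟨main.mapsTo hP, (key P).1 hl⟩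
  · rintro P ⟨hP, -⟩ P' ⟨hP', -⟩ h
    exact main.injOn hP hP' h
  · rintro T ⟨hT, hl⟩
    obtain ⟨P, hP, rfl⟩ := main.surjOn hT
    exact ⟨P, ⟨hP, (key P).2 hl⟩, rfl⟩
end

section
/- For every n ≥ 1, the map 𝒟' is a bijection from the set 𝒟_n of admissible edge labelings of the square grid graph □_n to the set 𝒯_{4,n} of interlacing triangular arrays of rank 4 and height n; moreover, for each tuple λ = (λ^{(1)},λ^{(2)},λ^{(3)},λ^{(4)}) ∈ ({1,2,3,4}^n)⁴ it restricts to a bijection from the labelings whose boundary reads λ to the arrays with top row λ. -/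
/-- Edges of the square grid `□_n`: `(0, x, y)` is the horizontal edge
`{(x,y),(x+1,y)}` (for `x < n`, `y ≤ n`) and `(1, x, y)` is the vertical edge
`{(x,y),(x,y+1)}` (for `x ≤ n`, `y < n`).  `D ∈ 𝒟_n` iff every edge of `□_n`
is labeled in `{1,2,3,4}`; every main-diagonal face has four pairwise distinct
edge labels; and every off-diagonal face (south `D 0 x y`, north `D 0 x (y+1)`,
west `D 1 x y`, east `D 1 (x+1) y`) uses exactly two distinct labels, either with
west = south and north = east, or with north = south and west = east. -/
def IsSquareLab (n : ℕ) (D : ℕ → ℕ → ℕ → ℕ) : Prop :=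
  (∀ x y, x < n → y ≤ n → D 0 x y ∈ Finset.Icc 1 4) ∧
  (∀ x y, x ≤ n → y < n → D 1 x y ∈ Finset.Icc 1 4) ∧
  (∀ x, x < n →
      (D 0 x x ≠ D 0 x (x + 1) ∧ D 0 x x ≠ D 1 x x ∧ D 0 x x ≠ D 1 (x + 1) x ∧
       D 0 x (x + 1) ≠ D 1 x x ∧ D 0 x (x + 1) ≠ D 1 (x + 1) x ∧
       D 1 x x ≠ D 1 (x + 1) x)) ∧
  (∀ x y, x < n → y < n → x ≠ y →
      ((D 1 x y = D 0 x y ∧ D 0 x (y + 1) = D 1 (x + 1) y ∧ D 1 x y ≠ D 0 x (y + 1)) ∨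
       (D 0 x (y + 1) = D 0 x y ∧ D 1 x y = D 1 (x + 1) y ∧ D 0 x y ≠ D 1 x y)))

/-- The map `𝒟'`: the `k`-th row of `𝒟'(D)` reads the boundary of the copy of
`□_k` inside `□_n` clockwise from the base point `(0,0)`: the left side bottom to
top (`T^(1)`), the top side left to right (`T^(2)`), the right side top to bottom
(`T^(3)`), and the bottom side right to left (`T^(4)`). -/
def TofD (n : ℕ) (D : ℕ → ℕ → ℕ → ℕ) : ℕ → ℕ → ℕ → ℕ :=
  fun i j k =>
    if 1 ≤ j ∧ j ≤ k ∧ k ≤ n then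
      if i = 1 then D 1 0 (j - 1)
      else if i = 2 then D 0 (j - 1) k
      else if i = 3 then D 1 k (k - j)
      else if i = 4 then D 0 (k - j) 0
      else 0
    else 0

/-- The set `𝒟_n`, normalized to `0` off the edge set of `□_n`. -/
def DFull (n : ℕ) : Set (ℕ → ℕ → ℕ → ℕ) :=
  {D | IsSquareLab n D ∧
      (∀ x y, ¬(x < n ∧ y ≤ n) → D 0 x y = 0) ∧
      (∀ x y, ¬(x ≤ n ∧ y < n) → D 1 x y = 0) ∧
      (∀ d x y, d ≠ 0 → d ≠ 1 → D d x y = 0)}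

/-- The entries equal to `a` in row `k` up to place `(i, j)` in reading order. -/
def preSet (T : ℕ → ℕ → ℕ → ℕ) (k a i j : ℕ) : Finset (ℕ × ℕ) :=
  (Finset.Icc 1 4 ×ˢ Finset.Icc 1 k).filter
    (fun p => T p.1 p.2 k = a ∧ (p.1 < i ∨ p.1 = i ∧ p.2 ≤ j))

/-- The entries equal to `a` in row `k`. -/
def rowSet (T : ℕ → ℕ → ℕ → ℕ) (k a : ℕ) : Finset (ℕ × ℕ) :=
  (Finset.Icc 1 4 ×ˢ Finset.Icc 1 k).filter (fun p => T p.1 p.2 k = a)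

/-- Prefix counts. -/
def preCnt (T : ℕ → ℕ → ℕ → ℕ) (k a i j : ℕ) : ℕ := (preSet T k a i j).card

lemma mem_preSet (T : ℕ → ℕ → ℕ → ℕ) (k a i j : ℕ) (p : ℕ × ℕ) :
    p ∈ preSet T k a i j ↔ (1 ≤ p.1 ∧ p.1 ≤ 4 ∧ 1 ≤ p.2 ∧ p.2 ≤ k) ∧ T p.1 p.2 k = a ∧
      (p.1 < i ∨ p.1 = i ∧ p.2 ≤ j) := by
  simp [preSet, and_assoc]

lemma mem_rowSet (T : ℕ → ℕ → ℕ → ℕ) (k a : ℕ) (p : ℕ × ℕ) :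
    p ∈ rowSet T k a ↔ (1 ≤ p.1 ∧ p.1 ≤ 4 ∧ 1 ≤ p.2 ∧ p.2 ≤ k) ∧ T p.1 p.2 k = a := by
  simp [rowSet, and_assoc]

lemma preCnt_start (T : ℕ → ℕ → ℕ → ℕ) (k a : ℕ) : preCnt T k a 1 0 = 0 := by
  rw [preCnt, Finset.card_eq_zero, Finset.eq_empty_iff_forall_notMem]
  intro p hp
  rw [mem_preSet] at hp
  omega

lemma preCnt_next (T : ℕ → ℕ → ℕ → ℕ) (k a i : ℕ) :
    preCnt T k a (i + 1) 0 = preCnt T k a i k := by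
  rw [preCnt, preCnt]
  congr 1
  ext p
  rw [mem_preSet, mem_preSet]
  constructor
  · rintro ⟨h, h1, h2⟩
    exact ⟨h, h1, by omega⟩
  · rintro ⟨h, h1, h2⟩
    exact ⟨h, h1, by omega⟩

lemma preCnt_end (T : ℕ → ℕ → ℕ → ℕ) (k a : ℕ) :
    preCnt T k a 4 k = (rowSet T k a).card := by
  rw [preCnt]
  congr 1
  ext p
  rw [mem_preSet, mem_rowSet]
  constructor
  · rintro ⟨h, h1, h2⟩
    exact ⟨h, h1⟩
  · rintro ⟨h, h1⟩
    exact ⟨h, h1, by omega⟩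

lemma preCnt_succ (T : ℕ → ℕ → ℕ → ℕ) (k a i j : ℕ) (hi : 1 ≤ i) (hi' : i ≤ 4)
    (hj : j + 1 ≤ k) :
    preCnt T k a i (j + 1) = preCnt T k a i j + if T i (j + 1) k = a then 1 else 0 := by
  split_ifs with h
  · have h1 : preSet T k a i (j + 1) = insert (i, j + 1) (preSet T k a i j) := by
      ext p
      rw [Finset.mem_insert, mem_preSet, mem_preSet]
      constructor
      · rintro ⟨h1, h2, h3⟩
        by_cases h4 : p.1 = i ∧ p.2 = j + 1
        · left; exact Prod.ext h4.1 h4.2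
        · right; exact ⟨h1, h2, by omega⟩
      · rintro (rfl | ⟨h1, h2, h3⟩)
        · refine ⟨?_, h, ?_⟩ <;> simp <;> omega
        · exact ⟨h1, h2, by omega⟩
    rw [preCnt, h1, Finset.card_insert_of_notMem, preCnt]
    rw [mem_preSet]
    simp
  · simp only [add_zero]
    refine congrArg Finset.card (Finset.ext fun p => ?_)
    rw [mem_preSet, mem_preSet]
    constructor
    · rintro ⟨h1, h2, h3⟩
      refine ⟨h1, h2, ?_⟩
      by_cases h4 : p.1 = i ∧ p.2 = j + 1
      · rw [h4.1, h4.2] at h2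
        exact absurd h2 h
      · omega
    · rintro ⟨h1, h2, h3⟩
      exact ⟨h1, h2, by omega⟩

/-- Rows `k` and `k+1` interlace, in terms of prefix counts. -/
def RowInter (T : ℕ → ℕ → ℕ → ℕ) (k : ℕ) : Prop :=
  ∀ a i j, 1 ≤ a → a ≤ 4 → 1 ≤ i → i ≤ 4 → j ≤ k →
    preCnt T k a i j ≤ preCnt T (k + 1) a i j ∧
    preCnt T (k + 1) a i (j + 1) ≤ preCnt T k a i j + 1

lemma four_cases {i : ℕ} (h : 1 ≤ i) (h' : i ≤ 4) : i = 1 ∨ i = 2 ∨ i = 3 ∨ i = 4 := by omega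

lemma Hc_same {n k i j i' j' : ℕ} (hk : k ≤ n) (h1 : 1 ≤ i) (h2 : i ≤ 4) (h3 : 1 ≤ j)
    (h4 : j ≤ k) (h1' : 1 ≤ i') (h2' : i' ≤ 4) (h3' : 1 ≤ j') (h4' : j' ≤ k) :
    Hc n i j k < Hc n i' j' k ↔ i < i' ∨ i = i' ∧ j < j' := by
  unfold Hc
  rcases four_cases h1 h2 with rfl | rfl | rfl | rfl <;>
  rcases four_cases h1' h2' with rfl | rfl | rfl | rfl <;>
  simp only [Nat.cast_ofNat, Nat.cast_one, true_and] <;> omega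

lemma Hc_down {n k i j i' j' : ℕ} (hk : k + 1 ≤ n) (h1 : 1 ≤ i) (h2 : i ≤ 4) (h3 : 1 ≤ j)
    (h4 : j ≤ k + 1) (h1' : 1 ≤ i') (h2' : i' ≤ 4) (h3' : 1 ≤ j') (h4' : j' ≤ k) :
    Hc n i j (k + 1) < Hc n i' j' k ↔ i < i' ∨ i = i' ∧ j ≤ j' := by
  unfold Hc
  rcases four_cases h1 h2 with rfl | rfl | rfl | rfl <;>
  rcases four_cases h1' h2' with rfl | rfl | rfl | rfl <;>
  simp only [Nat.cast_ofNat, Nat.cast_one, true_and] <;> omega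

lemma Hc_up {n k i j i' j' : ℕ} (hk : k + 1 ≤ n) (h1 : 1 ≤ i) (h2 : i ≤ 4) (h3 : 1 ≤ j)
    (h4 : j ≤ k + 1) (h1' : 1 ≤ i') (h2' : i' ≤ 4) (h3' : 1 ≤ j') (h4' : j' ≤ k) :
    Hc n i' j' k < Hc n i j (k + 1) ↔ i' < i ∨ i' = i ∧ j' < j := by
  unfold Hc
  rcases four_cases h1 h2 with rfl | rfl | rfl | rfl <;>
  rcases four_cases h1' h2' with rfl | rfl | rfl | rfl <;>
  simp only [Nat.cast_ofNat, Nat.cast_one, true_and] <;> omega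

lemma card_le_of_inter {α β : Type*} (s : Finset α) (t : Finset β)
    (f : α → ℤ) (g : β → ℤ) (hf : Set.InjOn f s)
    (h : ∀ x ∈ s, ∀ y ∈ s, f x < f y → ∃ z ∈ t, f x < g z ∧ g z < f y) :
    s.card ≤ t.card + 1 := by
  classical
  rw [← Finset.card_image_of_injOn hf]
  refine le_trans (Finset.card_le_of_interleaved (t := t.image g) ?_)
    (Nat.add_le_add_right Finset.card_image_le 1)
  intro x hx y hy hxy _
  rw [Finset.mem_image] at hx hy
  obtain ⟨x, hx, rfl⟩ := hx
  obtain ⟨y, hy, rfl⟩ := hy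
  obtain ⟨z, hz, h1, h2⟩ := h x hx y hy hxy
  exact ⟨g z, Finset.mem_image_of_mem g hz, h1, h2⟩

lemma Hc_injOn {n k : ℕ} (hk : k ≤ n) (s : Set (ℕ × ℕ))
    (hs : ∀ p ∈ s, 1 ≤ p.1 ∧ p.1 ≤ 4 ∧ 1 ≤ p.2 ∧ p.2 ≤ k) :
    Set.InjOn (fun p : ℕ × ℕ => Hc n p.1 p.2 k) s := by
  intro p hp q hq h
  obtain ⟨a1, a2, a3, a4⟩ := hs p hp
  obtain ⟨b1, b2, b3, b4⟩ := hs q hq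
  have h1 := Hc_same hk a1 a2 a3 a4 b1 b2 b3 b4
  have h2 := Hc_same hk b1 b2 b3 b4 a1 a2 a3 a4
  simp only at h
  rw [h] at h1 h2
  simp only [lt_irrefl, false_iff] at h1 h2
  exact Prod.ext (by omega) (by omega)

lemma preSet_subset (T : ℕ → ℕ → ℕ → ℕ) (k a i j : ℕ) : preSet T k a i j ⊆ rowSet T k a := by
  intro p hp
  rw [mem_preSet] at hp
  rw [mem_rowSet]
  exact ⟨hp.1, hp.2.1⟩

lemma inter_of_ITA {n : ℕ} {T : ℕ → ℕ → ℕ → ℕ} (h : IsITA 4 n T) {k : ℕ} (hk : k + 1 ≤ n) :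
    RowInter T k := by
  obtain ⟨_, hc, hb⟩ := h
  have hcard : ∀ k ≤ n, ∀ a, 1 ≤ a → a ≤ 4 → (rowSet T k a).card = k := by
    intro k hk a ha ha'
    rcases Nat.eq_zero_or_pos k with rfl | hp
    · rw [Finset.card_eq_zero, Finset.eq_empty_iff_forall_notMem]
      intro p hp
      rw [mem_rowSet] at hp
      omega
    · exact hc k hp hk a (Finset.mem_Icc.2 ⟨ha, ha'⟩)
  have key : ∀ a, ∀ x ∈ rowSet T (k + 1) a, ∀ y ∈ rowSet T (k + 1) a,
      Hc n x.1 x.2 (k + 1) < Hc n y.1 y.2 (k + 1) → ∃ z ∈ rowSet T k a,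
      (Hc n x.1 x.2 (k + 1) < Hc n z.1 z.2 k ∧ Hc n z.1 z.2 k < Hc n y.1 y.2 (k + 1)) ∧
      (x.1 < z.1 ∨ x.1 = z.1 ∧ x.2 ≤ z.2) ∧ (z.1 < y.1 ∨ z.1 = y.1 ∧ z.2 < y.2) := by
    intro a x hx y hy hxy
    rw [mem_rowSet] at hx hy
    obtain ⟨⟨a1, a2, a3, a4⟩, a5⟩ := hx
    obtain ⟨⟨b1, b2, b3, b4⟩, b5⟩ := hy
    obtain ⟨i, j, c1, c2, c3, c4, c5, c6, c7⟩ := hb (k + 1) (by omega) hk x.1 x.2 y.1 y.2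
      a1 a2 a3 a4 b1 b2 b3 b4 (a5.trans b5.symm) hxy
    simp only [Nat.add_sub_cancel] at c4 c5 c6 c7
    refine ⟨(i, j), ?_, ⟨c6, c7⟩, (Hc_down hk a1 a2 a3 a4 c1 c2 c3 c4).1 c6,
      (Hc_up hk b1 b2 b3 b4 c1 c2 c3 c4).1 c7⟩
    rw [mem_rowSet]
    exact ⟨⟨c1, c2, c3, c4⟩, c5.trans a5⟩
  intro a i j ha ha' hi hi' hj
  constructor
  · have h1 : (rowSet T (k + 1) a \ preSet T (k + 1) a i j).card ≤
        (rowSet T k a \ preSet T k a i j).card + 1 := by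
      refine card_le_of_inter _ _ (fun p => Hc n p.1 p.2 (k + 1)) (fun p => Hc n p.1 p.2 k)
        (Hc_injOn hk _ ?_) ?_
      · intro p hp
        have hp := (Finset.mem_sdiff.1 (Finset.mem_coe.1 hp)).1
        exact ((mem_rowSet _ _ _ _).1 hp).1
      · intro x hx y hy hxy
        rw [Finset.mem_sdiff] at hx hy
        obtain ⟨z, hz, h1, h2, h3⟩ := key a x hx.1 y hy.1 hxy
        refine ⟨z, ?_, h1⟩
        rw [Finset.mem_sdiff]
        refine ⟨hz, fun hz' => hx.2 ?_⟩
        rw [mem_preSet] at hz' ⊢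
        have := (mem_rowSet _ _ _ _).1 hx.1
        exact ⟨this.1, this.2, by omega⟩
    rw [Finset.card_sdiff_of_subset (preSet_subset _ _ _ _ _),
      Finset.card_sdiff_of_subset (preSet_subset _ _ _ _ _), hcard _ hk a ha ha',
      hcard k (by omega) a ha ha'] at h1
    have h2 := Finset.card_le_card (preSet_subset T k a i j)
    have h3 := Finset.card_le_card (preSet_subset T (k + 1) a i j)
    rw [hcard _ hk a ha ha'] at h3
    rw [hcard k (by omega) a ha ha'] at h2
    unfold preCnt
    omega
  · refine card_le_of_inter _ _ (fun p => Hc n p.1 p.2 (k + 1)) (fun p => Hc n p.1 p.2 k)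
        (Hc_injOn hk _ ?_) ?_
    · intro p hp
      exact ((mem_preSet _ _ _ _ _ _).1 (Finset.mem_coe.1 hp)).1
    · intro x hx y hy hxy
      obtain ⟨z, hz, h1, h2, h3⟩ := key a x (preSet_subset _ _ _ _ _ hx) y
        (preSet_subset _ _ _ _ _ hy) hxy
      refine ⟨z, ?_, h1⟩
      rw [mem_preSet] at hy ⊢
      rw [mem_rowSet] at hz
      exact ⟨hz.1, hz.2, by omega⟩

lemma ITA_of_inter {n : ℕ} {T : ℕ → ℕ → ℕ → ℕ}
    (hr : ∀ i j k, 1 ≤ i → i ≤ 4 → 1 ≤ j → j ≤ k → k ≤ n → 1 ≤ T i j k ∧ T i j k ≤ 4)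
    (hc : ∀ k, k + 1 ≤ n → ∀ a, 1 ≤ a → a ≤ 4 → preCnt T (k + 1) a 4 (k + 1) = k + 1)
    (hI : ∀ k, k + 1 ≤ n → RowInter T k) : IsITA 4 n T := by
  refine ⟨?_, ?_, ?_⟩
  · intro i j k h1 h2 h3 h4 h5
    exact Finset.mem_Icc.2 (hr i j k h1 h2 h3 h4 h5)
  · intro k hk hkn a ha
    obtain ⟨k, rfl⟩ : ∃ k', k = k' + 1 := ⟨k - 1, by omega⟩
    rw [Finset.mem_Icc] at ha
    exact (preCnt_end T (k + 1) a).symm.trans (hc k hkn a ha.1 ha.2)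
  · intro k hk hkn i j i' j' a1 a2 a3 a4 b1 b2 b3 b4 hT hH
    obtain ⟨k, rfl⟩ : ∃ k', k = k' + 1 := ⟨k - 1, by omega⟩
    simp only [Nat.add_sub_cancel]
    rw [Hc_same hkn a1 a2 a3 a4 b1 b2 b3 b4] at hH
    obtain ⟨j, rfl⟩ : ∃ k', j = k' + 1 := ⟨j - 1, by omega⟩
    obtain ⟨j', rfl⟩ : ∃ k', j' = k' + 1 := ⟨j' - 1, by omega⟩
    have ha := hr i (j + 1) (k + 1) a1 a2 a3 a4 hkn
    generalize hA : T i (j + 1) (k + 1) = a at *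
    have e1 := (hI k hkn a i j ha.1 ha.2 a1 a2 (by omega)).1
    have e2 := (hI k hkn a i' j' ha.1 ha.2 b1 b2 (by omega)).2
    have e3 := preCnt_succ T (k + 1) a i j a1 a2 a4
    have e4 := preCnt_succ T (k + 1) a i' j' b1 b2 b4
    rw [if_pos hA] at e3
    rw [if_pos hT.symm] at e4
    have e5 : preCnt T (k + 1) a i (j + 1) ≤ preCnt T (k + 1) a i' j' := by
      refine Finset.card_le_card fun p hp => ?_
      rw [mem_preSet] at hp ⊢
      exact ⟨hp.1, hp.2.1, by omega⟩
    have e6 : preCnt T k a i j < preCnt T k a i' j' := by omega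
    obtain ⟨z, hz, hz'⟩ := Finset.exists_mem_notMem_of_card_lt_card e6
    rw [mem_preSet] at hz hz'
    obtain ⟨⟨c1, c2, c3, c4⟩, c5, c6⟩ := hz
    refine ⟨z.1, z.2, c1, c2, c3, c4, c5, ?_, ?_⟩
    · rw [Hc_down hkn a1 a2 a3 a4 c1 c2 c3 c4]
      by_contra hcon
      exact hz' ⟨⟨c1, c2, c3, c4⟩, c5, by omega⟩
    · rw [Hc_up hkn b1 b2 b3 b4 c1 c2 c3 c4]
      omega

/-- Indicator. -/
def chi (b a : ℕ) : ℕ := if b = a then 1 else 0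

lemma chi_self (a : ℕ) : chi a a = 1 := if_pos rfl

lemma chi_ne {b a : ℕ} (h : b ≠ a) : chi b a = 0 := if_neg h

lemma chi_le (b a : ℕ) : chi b a ≤ 1 := by
  unfold chi; split_ifs <;> omega

lemma chi_add_le {b c : ℕ} (h : b ≠ c) (a : ℕ) : chi b a + chi c a ≤ 1 := by
  unfold chi; split_ifs <;> omega

lemma cnt_succ (T : ℕ → ℕ → ℕ → ℕ) (k a i j : ℕ) (hi : 1 ≤ i) (hi' : i ≤ 4)
    (hj : j + 1 ≤ k) :
    preCnt T k a i (j + 1) = preCnt T k a i j + chi (T i (j + 1) k) a :=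
  preCnt_succ T k a i j hi hi' hj

lemma chi_sum {w x y z a : ℕ} (hw : 1 ≤ w ∧ w ≤ 4) (hx : 1 ≤ x ∧ x ≤ 4) (hy : 1 ≤ y ∧ y ≤ 4)
    (hz : 1 ≤ z ∧ z ≤ 4) (ha : 1 ≤ a ∧ a ≤ 4) (h1 : w ≠ x) (h2 : w ≠ y) (h3 : w ≠ z)
    (h4 : x ≠ y) (h5 : x ≠ z) (h6 : y ≠ z) : chi w a + chi x a + chi y a + chi z a = 1 := by
  unfold chi
  obtain ⟨ha1, ha2⟩ := ha
  rcases four_cases ha1 ha2 with rfl | rfl | rfl | rfl <;> split_ifs <;> omega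

section forward

variable {n : ℕ} {D : ℕ → ℕ → ℕ → ℕ}

lemma TofD_one {j k : ℕ} (h : j + 1 ≤ k) (hk : k ≤ n) : TofD n D 1 (j + 1) k = D 1 0 j := by
  simp [TofD, h, hk]

lemma TofD_two {j k : ℕ} (h : j + 1 ≤ k) (hk : k ≤ n) : TofD n D 2 (j + 1) k = D 0 j k := by
  simp [TofD, h, hk]

lemma TofD_three {j k : ℕ} (h : j + 1 ≤ k) (hk : k ≤ n) :
    TofD n D 3 (j + 1) k = D 1 k (k - (j + 1)) := by
  simp [TofD, h, hk]

lemma TofD_four {j k : ℕ} (h : j + 1 ≤ k) (hk : k ≤ n) :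
    TofD n D 4 (j + 1) k = D 0 (k - (j + 1)) 0 := by
  simp [TofD, h, hk]

lemma f_tri1 {k : ℕ} (hk : k + 1 ≤ n) (a j : ℕ) (hj : j ≤ k) :
    preCnt (TofD n D) (k + 1) a 1 j = preCnt (TofD n D) k a 1 j := by
  induction j with
  | zero => rw [preCnt_start, preCnt_start]
  | succ j ih =>
    rw [cnt_succ _ _ _ _ _ le_rfl (by omega) (by omega),
      cnt_succ _ _ _ _ _ le_rfl (by omega) (by omega), ih (by omega),
      TofD_one (by omega) hk, TofD_one hj (by omega)]

lemma f_tri2 (hD : IsSquareLab n D) {k : ℕ} (hk : k + 1 ≤ n) (a j : ℕ) (hj : j ≤ k) :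
    preCnt (TofD n D) (k + 1) a 2 j = preCnt (TofD n D) k a 2 j + chi (D 1 j k) a := by
  induction j with
  | zero =>
    rw [preCnt_next _ _ _ 1, preCnt_next _ _ _ 1,
      cnt_succ _ _ _ _ _ le_rfl (by omega) (by omega), f_tri1 hk a k le_rfl,
      TofD_one (by omega) hk]
  | succ j ih =>
    have ih := ih (by omega)
    rw [cnt_succ _ _ _ _ _ (by omega) (by omega) (by omega),
      cnt_succ _ _ _ _ _ (by omega) (by omega) (by omega), ih,
      TofD_two (by omega) hk, TofD_two hj (by omega)]
    rcases hD.2.2.2 j k (by omega) (by omega) (by omega) with ⟨h1, h2, h3⟩ | ⟨h1, h2, h3⟩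
    · rw [h1, h2]
    · rw [h1, h2]; omega

lemma f_mid2 (hD : IsSquareLab n D) {k : ℕ} (hk : k + 1 ≤ n) (a j : ℕ) (hj : j ≤ k) :
    preCnt (TofD n D) (k + 1) a 2 (j + 1) =
      preCnt (TofD n D) k a 2 j + chi (D 1 j k) a + chi (D 0 j (k + 1)) a := by
  rw [cnt_succ _ _ _ _ _ (by omega) (by omega) (by omega), f_tri2 hD hk a j hj,
    TofD_two (by omega) hk]

lemma f_ne2 (hD : IsSquareLab n D) {k j : ℕ} (hk : k + 1 ≤ n) (hj : j ≤ k) :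
    D 1 j k ≠ D 0 j (k + 1) := by
  rcases Nat.lt_or_ge j k with h | h
  · rcases hD.2.2.2 j k (by omega) (by omega) (by omega) with ⟨h1, h2, h3⟩ | ⟨h1, h2, h3⟩
    · exact h3
    · rw [h1]; exact h3.symm
  · obtain rfl : j = k := by omega
    exact (hD.2.2.1 j (by omega)).2.2.2.1.symm

lemma f_tri3 (hD : IsSquareLab n D) {k : ℕ} (hk : k + 1 ≤ n) (a j : ℕ) (ha : 1 ≤ a ∧ a ≤ 4)
    (hj : j ≤ k) :
    preCnt (TofD n D) (k + 1) a 3 (j + 1) + chi (D 0 k (k - j)) a =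
      preCnt (TofD n D) k a 3 j + 1 := by
  induction j with
  | zero =>
    rw [cnt_succ _ _ _ _ _ (by omega) (by omega) (by omega), preCnt_next _ _ _ 2,
      preCnt_next _ _ _ 2, f_mid2 hD hk a k le_rfl, TofD_three (by omega) hk]
    simp only [Nat.sub_zero, Nat.zero_add, Nat.add_sub_cancel]
    obtain ⟨h1, h2, h3, h4, h5, h6⟩ := hD.2.2.1 k (by omega)
    have := chi_sum (a := a) (Finset.mem_Icc.1 (hD.1 k k (by omega) (by omega)))
      (Finset.mem_Icc.1 (hD.1 k (k + 1) (by omega) (by omega)))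
      (Finset.mem_Icc.1 (hD.2.1 k k (by omega) (by omega)))
      (Finset.mem_Icc.1 (hD.2.1 (k + 1) k (by omega) (by omega))) ha h1 h2 h3 h4 h5 h6
    omega
  | succ j ih =>
    have ih := ih (by omega)
    rw [cnt_succ _ (k + 1) _ _ (j + 1) (by omega) (by omega) (by omega),
      cnt_succ _ k _ _ j (by omega) (by omega) (by omega),
      TofD_three (by omega) hk, TofD_three hj (by omega)]
    have e : k + 1 - (j + 1 + 1) = k - (j + 1) := by omega
    have e2 : k - j = k - (j + 1) + 1 := by omega
    rw [e]
    rw [e2] at ih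
    rcases hD.2.2.2 k (k - (j + 1)) (by omega) (by omega) (by omega) with
      ⟨h1, h2, h3⟩ | ⟨h1, h2, h3⟩
    · rw [h2] at ih; rw [h1]; omega
    · rw [h1] at ih; rw [h2]; omega

lemma f_tri4 (hD : IsSquareLab n D) {k : ℕ} (hk : k + 1 ≤ n) (a j : ℕ) (ha : 1 ≤ a ∧ a ≤ 4)
    (hj : j ≤ k) :
    preCnt (TofD n D) (k + 1) a 4 (j + 1) = preCnt (TofD n D) k a 4 j + 1 := by
  induction j with
  | zero =>
    have h := f_tri3 hD hk a k ha le_rfl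
    rw [cnt_succ _ _ _ _ _ (by omega) (by omega) (by omega), preCnt_next _ _ _ 3,
      preCnt_next _ _ _ 3, TofD_four (by omega) hk]
    simp only [Nat.sub_self, Nat.zero_add, Nat.add_sub_cancel] at h ⊢
    omega
  | succ j ih =>
    have ih := ih (by omega)
    rw [cnt_succ _ (k + 1) _ _ (j + 1) (by omega) (by omega) (by omega),
      cnt_succ _ k _ _ j (by omega) (by omega) (by omega),
      TofD_four (by omega) hk, TofD_four hj (by omega)]
    have e : k + 1 - (j + 1 + 1) = k - (j + 1) := by omega
    rw [e]
    omega

lemma f_inter (hD : IsSquareLab n D) {k : ℕ} (hk : k + 1 ≤ n) : RowInter (TofD n D) k := by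
  intro a i j ha ha' hi hi' hj
  rcases four_cases hi hi' with rfl | rfl | rfl | rfl
  · have h := f_tri1 (D := D) hk a j hj
    have h2 := cnt_succ (TofD n D) (k + 1) a 1 j le_rfl (by omega) (by omega)
    have h3 := chi_le (TofD n D 1 (j + 1) (k + 1)) a
    omega
  · have h := f_tri2 hD hk a j hj
    have h2 := f_mid2 hD hk a j hj
    have h3 := chi_add_le (f_ne2 hD hk hj) a
    omega
  · have h := f_tri3 hD hk a j ⟨ha, ha'⟩ hj
    refine ⟨?_, by omega⟩
    cases j with
    | zero =>
      have h2 := f_mid2 hD hk a k le_rfl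
      rw [preCnt_next _ _ _ 2, preCnt_next _ _ _ 2]
      omega
    | succ j =>
      have h' := f_tri3 hD hk a j ⟨ha, ha'⟩ (by omega)
      have h2 := cnt_succ (TofD n D) k a 3 j (by omega) (by omega) (by omega)
      rw [TofD_three hj (by omega)] at h2
      have e2 : k - j = k - (j + 1) + 1 := by omega
      rw [e2] at h'
      have h3 : D 1 k (k - (j + 1)) ≠ D 0 k (k - (j + 1) + 1) := by
        rcases hD.2.2.2 k (k - (j + 1)) (by omega) (by omega) (by omega) with
          ⟨h1, h2, h3⟩ | ⟨h1, h2, h3⟩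
        · exact h3
        · rw [h1]; exact h3.symm
      have h4 := chi_add_le h3 a
      omega
  · have h := f_tri4 hD hk a j ⟨ha, ha'⟩ hj
    have h2 := cnt_succ (TofD n D) (k + 1) a 4 j (by omega) (by omega) (by omega)
    have h3 := chi_le (TofD n D 4 (j + 1) (k + 1)) a
    omega

lemma f_count (hD : IsSquareLab n D) {k : ℕ} (hk : k ≤ n) (a : ℕ) (ha : 1 ≤ a ∧ a ≤ 4) :
    preCnt (TofD n D) k a 4 k = k := by
  induction k with
  | zero =>
    rw [preCnt_next _ _ _ 3, preCnt_next _ _ _ 2, preCnt_next _ _ _ 1, preCnt_start]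
  | succ k ih =>
    rw [f_tri4 hD hk a k ha le_rfl, ih (by omega)]

lemma f_mapsTo : Set.MapsTo (TofD n) (DFull n) (ITAFull 4 n) := by
  rintro D ⟨hD, -⟩
  refine ⟨ITA_of_inter ?_ (fun k hk a ha ha' => f_count hD hk a ⟨ha, ha'⟩)
    (fun k hk => f_inter hD hk), ?_⟩
  · intro i j k h1 h2 h3 h4 h5
    obtain ⟨j, rfl⟩ : ∃ k', j = k' + 1 := ⟨j - 1, by omega⟩
    rcases four_cases h1 h2 with rfl | rfl | rfl | rfl
    · rw [TofD_one h4 h5]; exact Finset.mem_Icc.1 (hD.2.1 _ _ (by omega) (by omega))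
    · rw [TofD_two h4 h5]; exact Finset.mem_Icc.1 (hD.1 _ _ (by omega) (by omega))
    · rw [TofD_three h4 h5]; exact Finset.mem_Icc.1 (hD.2.1 _ _ (by omega) (by omega))
    · rw [TofD_four h4 h5]; exact Finset.mem_Icc.1 (hD.1 _ _ (by omega) (by omega))
  · intro i j k h
    unfold TofD
    split_ifs <;> first | rfl | omega

lemma f_injOn : Set.InjOn (TofD n) (DFull n) := by
  rintro D ⟨hD, hD0, hD1, hD2⟩ D' ⟨hD', hD0', hD1', hD2'⟩ h
  have e1 : ∀ y, y < n → D 1 0 y = D' 1 0 y := fun y hy => by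
    rw [← TofD_one (n := n) (D := D) (k := n) hy le_rfl, h, TofD_one hy le_rfl]
  have e2 : ∀ x y, x < y → y ≤ n → D 0 x y = D' 0 x y := fun x y hx hy => by
    rw [← TofD_two (n := n) (D := D) hx hy, h, TofD_two hx hy]
  have e3 : ∀ x y, y < x → x ≤ n → D 1 x y = D' 1 x y := fun x y hx hy => by
    have e : y = x - (x - y - 1 + 1) := by omega
    have h1 := TofD_three (n := n) (D := D) (j := x - y - 1) (k := x) (by omega) hy
    have h2 := TofD_three (n := n) (D := D') (j := x - y - 1) (k := x) (by omega) hy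
    rw [← e] at h1 h2
    rw [← h1, ← h2, h]
  have e4 : ∀ x, x < n → D 0 x 0 = D' 0 x 0 := fun x hx => by
    have h1 := TofD_four (n := n) (D := D) (j := 0) (k := x + 1) (by omega) hx
    have h2 := TofD_four (n := n) (D := D') (j := 0) (k := x + 1) (by omega) hx
    simp only [Nat.zero_add, Nat.add_sub_cancel] at h1 h2
    rw [← h1, ← h2, h]
  have e5 : ∀ x y, x ≤ y → y < n → D 1 x y = D' 1 x y := by
    intro x y hx hy
    induction x with
    | zero => exact e1 y hy
    | succ x ih =>
      have ih := ih (by omega)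
      have a1 := e2 x y (by omega) (by omega)
      have a2 := e2 x (y + 1) (by omega) (by omega)
      have f := hD.2.2.2 x y (by omega) hy (by omega)
      have f' := hD'.2.2.2 x y (by omega) hy (by omega)
      omega
  have e6 : ∀ x y, y ≤ x → x < n → D 0 x y = D' 0 x y := by
    intro x y hy hx
    induction y with
    | zero => exact e4 x hx
    | succ y ih =>
      have ih := ih (by omega)
      have a1 := e3 x y (by omega) (by omega)
      have a2 := e3 (x + 1) y (by omega) (by omega)
      have f := hD.2.2.2 x y hx (by omega) (by omega)
      have f' := hD'.2.2.2 x y hx (by omega) (by omega)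
      omega
  funext d x y
  by_cases hd : d = 0
  · subst hd
    by_cases hxy : x < n ∧ y ≤ n
    · rcases Nat.lt_or_ge x y with h1 | h1
      · exact e2 x y h1 hxy.2
      · exact e6 x y h1 hxy.1
    · rw [hD0 x y hxy, hD0' x y hxy]
  by_cases hd1 : d = 1
  · subst hd1
    by_cases hxy : x ≤ n ∧ y < n
    · rcases Nat.lt_or_ge y x with h1 | h1
      · exact e3 x y h1 hxy.1
      · exact e5 x y h1 hxy.2
    · rw [hD1 x y hxy, hD1' x y hxy]
  rw [hD2 d x y hd hd1, hD2' d x y hd hd1]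

end forward

/-- Reconstructed vertical labels on or above the diagonal, in the strip `k ≤ y ≤ k+1`. -/
def Wd (T : ℕ → ℕ → ℕ → ℕ) (k : ℕ) : ℕ → ℕ
  | 0 => T 1 (k + 1) (k + 1)
  | j + 1 => if T 2 (j + 1) k = Wd T k j then T 2 (j + 1) (k + 1) else Wd T k j

/-- Reconstructed horizontal labels on or below the diagonal, in the strip `k ≤ x ≤ k+1`. -/
def Vd (T : ℕ → ℕ → ℕ → ℕ) (k : ℕ) : ℕ → ℕ
  | 0 => 10 - Wd T k k - T 2 (k + 1) (k + 1) - T 3 1 (k + 1)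
  | j + 1 => if T 3 (j + 2) (k + 1) = Vd T k j then T 3 (j + 1) k else Vd T k j

/-- The reconstructed labeling. -/
def DofT (n : ℕ) (T : ℕ → ℕ → ℕ → ℕ) : ℕ → ℕ → ℕ → ℕ := fun d x y =>
  if d = 0 then
    if x < n ∧ y ≤ n then (if x < y then T 2 (x + 1) y else Vd T x (x - y)) else 0
  else if d = 1 then
    if x ≤ n ∧ y < n then (if y < x then T 3 (x - y) x else Wd T y x) else 0
  else 0

section backward

variable {n : ℕ} {T : ℕ → ℕ → ℕ → ℕ}

/-- Range hypothesis. -/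
def RangeOK (n : ℕ) (T : ℕ → ℕ → ℕ → ℕ) : Prop :=
  ∀ i j k, 1 ≤ i → i ≤ 4 → 1 ≤ j → j ≤ k → k ≤ n → 1 ≤ T i j k ∧ T i j k ≤ 4

lemma b_tri1 (hr : RangeOK n T) {k : ℕ} (hk : k + 1 ≤ n) (hI : RowInter T k) (j : ℕ)
    (hj : j ≤ k) :
    (∀ a, 1 ≤ a → a ≤ 4 → preCnt T (k + 1) a 1 j = preCnt T k a 1 j) ∧
    (j < k → T 1 (j + 1) (k + 1) = T 1 (j + 1) k) := by
  have step : ∀ j, (∀ a, 1 ≤ a → a ≤ 4 → preCnt T (k + 1) a 1 j = preCnt T k a 1 j) →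
      (j < k → T 1 (j + 1) (k + 1) = T 1 (j + 1) k) := by
    intro j h hjk
    obtain ⟨r1, r2⟩ := hr 1 (j + 1) k le_rfl (by omega) (by omega) (by omega) (by omega)
    have h1 := h _ r1 r2
    have h2 := (hI _ 1 (j + 1) r1 r2 le_rfl (by omega) (by omega)).1
    rw [cnt_succ T k _ 1 j le_rfl (by omega) (by omega), chi_self,
      cnt_succ T (k + 1) _ 1 j le_rfl (by omega) (by omega)] at h2
    by_contra hne
    rw [chi_ne hne] at h2
    omega
  induction j with
  | zero =>
    have h : ∀ a, 1 ≤ a → a ≤ 4 → preCnt T (k + 1) a 1 0 = preCnt T k a 1 0 := by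
      intro a _ _
      rw [preCnt_start, preCnt_start]
    exact ⟨h, step _ h⟩
  | succ j ih =>
    have h : ∀ a, 1 ≤ a → a ≤ 4 → preCnt T (k + 1) a 1 (j + 1) = preCnt T k a 1 (j + 1) := by
      intro a ha ha'
      obtain ⟨h1, h2⟩ := ih (by omega)
      rw [cnt_succ T k _ 1 j le_rfl (by omega) (by omega),
        cnt_succ T (k + 1) _ 1 j le_rfl (by omega) (by omega), h1 a ha ha', h2 (by omega)]
    exact ⟨h, step _ h⟩

lemma b_mid2 (hr : RangeOK n T) {k : ℕ} (hk : k + 1 ≤ n) (hI : RowInter T k) (j w : ℕ)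
    (hj : j ≤ k)
    (h : ∀ a, 1 ≤ a → a ≤ 4 → preCnt T (k + 1) a 2 j = preCnt T k a 2 j + chi w a) :
    w ≠ T 2 (j + 1) (k + 1) := by
  rintro rfl
  obtain ⟨r1, r2⟩ := hr 2 (j + 1) (k + 1) (by omega) (by omega) (by omega) (by omega) (by omega)
  have h1 := h _ r1 r2
  have h2 := (hI _ 2 j r1 r2 (by omega) (by omega) (by omega)).2
  rw [cnt_succ T (k + 1) _ 2 j (by omega) (by omega) (by omega)] at h2
  rw [chi_self] at h1 h2
  omega

lemma b_low2 (hr : RangeOK n T) {k : ℕ} (hk : k + 1 ≤ n) (hI : RowInter T k) (j w : ℕ)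
    (hj : j < k)
    (h : ∀ a, 1 ≤ a → a ≤ 4 → preCnt T (k + 1) a 2 j = preCnt T k a 2 j + chi w a)
    (hne : T 2 (j + 1) k ≠ w) : T 2 (j + 1) (k + 1) = T 2 (j + 1) k := by
  obtain ⟨r1, r2⟩ := hr 2 (j + 1) k (by omega) (by omega) (by omega) (by omega) (by omega)
  have h1 := h _ r1 r2
  have h2 := (hI _ 2 (j + 1) r1 r2 (by omega) (by omega) (by omega)).1
  rw [cnt_succ T (k + 1) _ 2 j (by omega) (by omega) (by omega),
    cnt_succ T k _ 2 j (by omega) (by omega) (by omega), chi_self] at h2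
  rw [chi_ne hne.symm] at h1
  by_contra hc
  rw [chi_ne hc] at h2
  omega

lemma b_tri2 (hr : RangeOK n T) {k : ℕ} (hk : k + 1 ≤ n) (hI : RowInter T k) (j : ℕ)
    (hj : j ≤ k) : (1 ≤ Wd T k j ∧ Wd T k j ≤ 4) ∧
    ∀ a, 1 ≤ a → a ≤ 4 → preCnt T (k + 1) a 2 j = preCnt T k a 2 j + chi (Wd T k j) a := by
  induction j with
  | zero =>
    refine ⟨hr 1 _ _ le_rfl (by omega) (by omega) le_rfl hk, fun a ha ha' => ?_⟩
    rw [preCnt_next _ _ _ 1, preCnt_next _ _ _ 1, cnt_succ _ _ _ _ _ le_rfl (by omega) le_rfl,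
      (b_tri1 hr hk hI k le_rfl).1 a ha ha', Wd]
  | succ j ih =>
    obtain ⟨i1, i2⟩ := ih (by omega)
    have r := hr 2 (j + 1) (k + 1) (by omega) (by omega) (by omega) (by omega) (by omega)
    rw [Wd]
    split_ifs with hs
    · refine ⟨r, fun a ha ha' => ?_⟩
      rw [cnt_succ T (k + 1) _ 2 j (by omega) (by omega) (by omega),
        cnt_succ T k _ 2 j (by omega) (by omega) (by omega), i2 a ha ha', hs]
    · refine ⟨i1, fun a ha ha' => ?_⟩
      rw [cnt_succ T (k + 1) _ 2 j (by omega) (by omega) (by omega),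
        cnt_succ T k _ 2 j (by omega) (by omega) (by omega), i2 a ha ha',
        b_low2 hr hk hI j _ (by omega) i2 hs]
      omega

lemma b_face2 (hr : RangeOK n T) {k : ℕ} (hk : k + 1 ≤ n) (hI : RowInter T k) (j : ℕ)
    (hj : j < k) :
    (Wd T k j = T 2 (j + 1) k ∧ T 2 (j + 1) (k + 1) = Wd T k (j + 1) ∧
      Wd T k j ≠ T 2 (j + 1) (k + 1)) ∨
    (T 2 (j + 1) (k + 1) = T 2 (j + 1) k ∧ Wd T k j = Wd T k (j + 1) ∧
      T 2 (j + 1) k ≠ Wd T k j) := by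
  obtain ⟨i1, i2⟩ := b_tri2 hr hk hI j (by omega)
  have hm := b_mid2 hr hk hI j _ (by omega) i2
  rw [Wd]
  split_ifs with hs
  · exact Or.inl ⟨hs.symm, rfl, hm⟩
  · exact Or.inr ⟨b_low2 hr hk hI j _ hj i2 hs, rfl, hs⟩

lemma fourth {w x y : ℕ} (hw : 1 ≤ w ∧ w ≤ 4) (hx : 1 ≤ x ∧ x ≤ 4) (hy : 1 ≤ y ∧ y ≤ 4)
    (h1 : w ≠ x) (h2 : w ≠ y) (h3 : x ≠ y) :
    (1 ≤ 10 - w - x - y ∧ 10 - w - x - y ≤ 4) ∧ w ≠ 10 - w - x - y ∧ x ≠ 10 - w - x - y ∧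
      y ≠ 10 - w - x - y := by
  rcases four_cases hw.1 hw.2 with rfl | rfl | rfl | rfl <;>
  rcases four_cases hx.1 hx.2 with rfl | rfl | rfl | rfl <;> omega

lemma b_diag (hr : RangeOK n T) {k : ℕ} (hk : k + 1 ≤ n) (hI : RowInter T k) :
    (1 ≤ Vd T k 0 ∧ Vd T k 0 ≤ 4) ∧ Vd T k 0 ≠ T 2 (k + 1) (k + 1) ∧ Vd T k 0 ≠ Wd T k k ∧
    Vd T k 0 ≠ T 3 1 (k + 1) ∧ T 2 (k + 1) (k + 1) ≠ Wd T k k ∧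
    T 2 (k + 1) (k + 1) ≠ T 3 1 (k + 1) ∧ Wd T k k ≠ T 3 1 (k + 1) := by
  obtain ⟨i1, i2⟩ := b_tri2 hr hk hI k le_rfl
  have hm := b_mid2 hr hk hI k _ le_rfl i2
  have r := hr 2 (k + 1) (k + 1) (by omega) (by omega) (by omega) (by omega) (by omega)
  have r' := hr 3 1 (k + 1) (by omega) (by omega) (by omega) (by omega) (by omega)
  have h1 := i2 _ r'.1 r'.2
  have h2 := (hI _ 3 0 r'.1 r'.2 (by omega) (by omega) (by omega)).2
  rw [cnt_succ T (k + 1) _ 3 0 (by omega) (by omega) (by omega), preCnt_next _ _ _ 2,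
    preCnt_next _ _ _ 2, cnt_succ T (k + 1) _ 2 k (by omega) (by omega) (by omega), h1,
    chi_self] at h2
  have n1 : T 2 (k + 1) (k + 1) ≠ T 3 1 (k + 1) := by
    intro hc
    rw [hc, chi_self] at h2
    omega
  have n2 : Wd T k k ≠ T 3 1 (k + 1) := by
    intro hc
    rw [hc, chi_self] at h2
    omega
  obtain ⟨f1, f2, f3, f4⟩ := fourth i1 r r' hm n2 n1
  exact ⟨f1, f3.symm, f2.symm, f4.symm, hm.symm, n1, n2⟩

lemma b_up3 (hr : RangeOK n T) {k : ℕ} (hk : k + 1 ≤ n) (hI : RowInter T k) (j v : ℕ)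
    (hj : j < k)
    (h : ∀ a, 1 ≤ a → a ≤ 4 →
      preCnt T (k + 1) a 3 (j + 1) + chi v a = preCnt T k a 3 j + 1)
    (hne : T 3 (j + 2) (k + 1) ≠ v) : T 3 (j + 1) k = T 3 (j + 2) (k + 1) := by
  obtain ⟨r1, r2⟩ := hr 3 (j + 2) (k + 1) (by omega) (by omega) (by omega) (by omega) (by omega)
  have h1 := h _ r1 r2
  have h2 := (hI _ 3 (j + 1) r1 r2 (by omega) (by omega) (by omega)).2
  rw [cnt_succ T (k + 1) _ 3 (j + 1) (by omega) (by omega) (by omega),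
    cnt_succ T k _ 3 j (by omega) (by omega) (by omega), chi_self] at h2
  rw [chi_ne hne.symm] at h1
  by_contra hc
  rw [chi_ne hc] at h2
  omega

lemma b_low3 (hr : RangeOK n T) {k : ℕ} (hk : k + 1 ≤ n) (hI : RowInter T k) (j v : ℕ)
    (hj : j < k)
    (h : ∀ a, 1 ≤ a → a ≤ 4 →
      preCnt T (k + 1) a 3 (j + 1) + chi v a = preCnt T k a 3 j + 1) :
    T 3 (j + 1) k ≠ v := by
  rintro rfl
  obtain ⟨r1, r2⟩ := hr 3 (j + 1) k (by omega) (by omega) (by omega) (by omega) (by omega)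
  have h1 := h _ r1 r2
  have h2 := (hI _ 3 (j + 1) r1 r2 (by omega) (by omega) (by omega)).1
  rw [cnt_succ T k _ 3 j (by omega) (by omega) (by omega), chi_self] at h2
  rw [chi_self] at h1
  omega

lemma b_tri3 (hr : RangeOK n T) {k : ℕ} (hk : k + 1 ≤ n) (hI : RowInter T k) (j : ℕ)
    (hj : j ≤ k) : (1 ≤ Vd T k j ∧ Vd T k j ≤ 4) ∧
    ∀ a, 1 ≤ a → a ≤ 4 →
      preCnt T (k + 1) a 3 (j + 1) + chi (Vd T k j) a = preCnt T k a 3 j + 1 := by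
  induction j with
  | zero =>
    obtain ⟨d0, d1, d2, d3, d4, d5, d6⟩ := b_diag hr hk hI
    obtain ⟨i1, i2⟩ := b_tri2 hr hk hI k le_rfl
    refine ⟨d0, fun a ha ha' => ?_⟩
    have r := hr 2 (k + 1) (k + 1) (by omega) (by omega) (by omega) (by omega) (by omega)
    have r' := hr 3 1 (k + 1) (by omega) (by omega) (by omega) (by omega) (by omega)
    have := chi_sum d0 r i1 r' ⟨ha, ha'⟩ d1 d2 d3 d4 d5 d6
    rw [cnt_succ T (k + 1) _ 3 0 (by omega) (by omega) (by omega), preCnt_next _ _ _ 2,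
      preCnt_next _ _ _ 2, cnt_succ T (k + 1) _ 2 k (by omega) (by omega) (by omega),
      i2 a ha ha']
    simp only [Nat.zero_add]
    omega
  | succ j ih =>
    obtain ⟨i1, i2⟩ := ih (by omega)
    have r := hr 3 (j + 1) k (by omega) (by omega) (by omega) (by omega) (by omega)
    rw [Vd]
    split_ifs with hs
    · refine ⟨r, fun a ha ha' => ?_⟩
      have := i2 a ha ha'
      rw [cnt_succ T (k + 1) _ 3 (j + 1) (by omega) (by omega) (by omega),
        cnt_succ T k _ 3 j (by omega) (by omega) (by omega), hs]
      omega
    · refine ⟨i1, fun a ha ha' => ?_⟩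
      have := i2 a ha ha'
      rw [cnt_succ T (k + 1) _ 3 (j + 1) (by omega) (by omega) (by omega),
        cnt_succ T k _ 3 j (by omega) (by omega) (by omega),
        b_up3 hr hk hI j _ (by omega) i2 hs]
      simp only [Nat.add_assoc, Nat.reduceAdd] at this ⊢
      omega

lemma b_face3 (hr : RangeOK n T) {k : ℕ} (hk : k + 1 ≤ n) (hI : RowInter T k) (j : ℕ)
    (hj : j < k) :
    (T 3 (j + 1) k = Vd T k (j + 1) ∧ Vd T k j = T 3 (j + 2) (k + 1) ∧
      T 3 (j + 1) k ≠ Vd T k j) ∨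
    (Vd T k j = Vd T k (j + 1) ∧ T 3 (j + 1) k = T 3 (j + 2) (k + 1) ∧
      Vd T k (j + 1) ≠ T 3 (j + 1) k) := by
  obtain ⟨i1, i2⟩ := b_tri3 hr hk hI j (by omega)
  have hm := b_low3 hr hk hI j _ (by omega) i2
  rw [Vd]
  split_ifs with hs
  · exact Or.inl ⟨rfl, hs.symm, hm⟩
  · exact Or.inr ⟨rfl, b_up3 hr hk hI j _ hj i2 hs, hm.symm⟩

lemma b_corner (hr : RangeOK n T) {k : ℕ} (hk : k + 1 ≤ n) (hI : RowInter T k) :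
    T 4 1 (k + 1) = Vd T k k ∧
    ∀ a, 1 ≤ a → a ≤ 4 → preCnt T (k + 1) a 4 1 = preCnt T k a 4 0 + 1 := by
  obtain ⟨i1, i2⟩ := b_tri3 hr hk hI k le_rfl
  have r := hr 4 1 (k + 1) (by omega) (by omega) (by omega) (by omega) (by omega)
  have e : T 4 1 (k + 1) = Vd T k k := by
    have h1 := i2 _ r.1 r.2
    have h2 := (hI _ 4 0 r.1 r.2 (by omega) (by omega) (by omega)).2
    rw [cnt_succ T (k + 1) _ 4 0 (by omega) (by omega) (by omega), preCnt_next _ _ _ 3,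
      preCnt_next _ _ _ 3, chi_self] at h2
    by_contra hc
    rw [chi_ne (Ne.symm hc)] at h1
    omega
  refine ⟨e, fun a ha ha' => ?_⟩
  have h1 := i2 a ha ha'
  rw [cnt_succ T (k + 1) _ 4 0 (by omega) (by omega) (by omega), preCnt_next _ _ _ 3,
    preCnt_next _ _ _ 3]
  simp only [Nat.zero_add]
  rw [e]
  omega

lemma b_step4 (hr : RangeOK n T) {k : ℕ} (hk : k + 1 ≤ n) (hI : RowInter T k) (j : ℕ)
    (hj : j < k)
    (h : ∀ a, 1 ≤ a → a ≤ 4 → preCnt T (k + 1) a 4 (j + 1) = preCnt T k a 4 j + 1) :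
    T 4 (j + 1) k = T 4 (j + 2) (k + 1) := by
  obtain ⟨r1, r2⟩ := hr 4 (j + 2) (k + 1) (by omega) (by omega) (by omega) (by omega) (by omega)
  have h1 := h _ r1 r2
  have h2 := (hI _ 4 (j + 1) r1 r2 (by omega) (by omega) (by omega)).2
  rw [cnt_succ T (k + 1) _ 4 (j + 1) (by omega) (by omega) (by omega),
    cnt_succ T k _ 4 j (by omega) (by omega) (by omega), chi_self] at h2
  by_contra hc
  rw [chi_ne hc] at h2
  omega

lemma b_tri4 (hr : RangeOK n T) {k : ℕ} (hk : k + 1 ≤ n) (hI : RowInter T k) (j : ℕ)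
    (hj : j ≤ k) :
    ∀ a, 1 ≤ a → a ≤ 4 → preCnt T (k + 1) a 4 (j + 1) = preCnt T k a 4 j + 1 := by
  induction j with
  | zero => exact (b_corner hr hk hI).2
  | succ j ih =>
    intro a ha ha'
    have ih := ih (by omega)
    rw [cnt_succ T (k + 1) _ 4 (j + 1) (by omega) (by omega) (by omega),
      cnt_succ T k _ 4 j (by omega) (by omega) (by omega), ih a ha ha',
      b_step4 hr hk hI j (by omega) ih]
    simp only [Nat.add_assoc, Nat.reduceAdd]
    omega

lemma b_const1 (hr : RangeOK n T) (hI : ∀ k, k + 1 ≤ n → RowInter T k) (j d : ℕ)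
    (h : j + 1 + d ≤ n) : T 1 (j + 1) (j + 1 + d) = T 1 (j + 1) (j + 1) := by
  induction d with
  | zero => rfl
  | succ d ih =>
    rw [← ih (by omega)]
    exact (b_tri1 hr (by omega) (hI (j + 1 + d) (by omega)) j (by omega)).2 (by omega)

lemma b_const4 (hr : RangeOK n T) (hI : ∀ k, k + 1 ≤ n → RowInter T k) (k j : ℕ)
    (h : j + k + 1 ≤ n) : T 4 (j + 1) (k + 1 + j) = T 4 1 (k + 1) := by
  induction j with
  | zero => rfl
  | succ j ih =>
    rw [← ih (by omega)]
    exact (b_step4 hr (by omega) (hI (k + 1 + j) (by omega)) j (by omega)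
      (b_tri4 hr (by omega) (hI (k + 1 + j) (by omega)) j (by omega))).symm

lemma D_h_above {x y : ℕ} (h : x < y) (hy : y ≤ n) : DofT n T 0 x y = T 2 (x + 1) y := by
  simp only [DofT, if_true, if_pos h]
  rw [if_pos (by omega)]

lemma D_h_below {x y : ℕ} (h : y ≤ x) (hx : x < n) : DofT n T 0 x y = Vd T x (x - y) := by
  simp only [DofT, if_true, if_neg (Nat.not_lt.2 h)]
  rw [if_pos (by omega)]

lemma D_v_below {x y : ℕ} (h : y < x) (hx : x ≤ n) : DofT n T 1 x y = T 3 (x - y) x := by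
  simp only [DofT, if_true, one_ne_zero, if_false, if_pos h]
  rw [if_pos (by omega)]

lemma D_v_above {x y : ℕ} (h : x ≤ y) (hy : y < n) : DofT n T 1 x y = Wd T y x := by
  simp only [DofT, if_true, one_ne_zero, if_false, if_neg (Nat.not_lt.2 h)]
  rw [if_pos (by omega)]

lemma b_lab (hr : RangeOK n T) (hI : ∀ k, k + 1 ≤ n → RowInter T k) :
    IsSquareLab n (DofT n T) := by
  refine ⟨?_, ?_, ?_, ?_⟩
  · intro x y hx hy
    rw [Finset.mem_Icc]
    rcases Nat.lt_or_ge x y with h | h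
    · rw [D_h_above h hy]
      exact hr 2 _ _ (by omega) (by omega) (by omega) (by omega) hy
    · rw [D_h_below h hx]
      exact (b_tri3 hr hx (hI x hx) _ (by omega)).1
  · intro x y hx hy
    rw [Finset.mem_Icc]
    rcases Nat.lt_or_ge y x with h | h
    · rw [D_v_below h hx]
      exact hr 3 _ _ (by omega) (by omega) (by omega) (by omega) hx
    · rw [D_v_above h hy]
      exact (b_tri2 hr hy (hI y hy) _ (by omega)).1
  · intro x hx
    rw [D_h_below le_rfl hx, D_h_above (Nat.lt_add_one x) hx, D_v_above le_rfl hx,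
      D_v_below (Nat.lt_add_one x) hx]
    simp only [Nat.sub_self, Nat.add_sub_cancel_left]
    exact (b_diag hr hx (hI x hx)).2
  · intro x y hx hy hxy
    rcases Nat.lt_or_ge x y with h | h
    · rw [D_v_above (by omega) hy, D_h_above h (by omega), D_h_above (by omega) hy,
        D_v_above h hy]
      exact b_face2 hr hy (hI y hy) x h
    · obtain ⟨j, rfl⟩ : ∃ j, x = y + 1 + j := ⟨x - y - 1, by omega⟩
      rw [D_v_below (by omega) (by omega), D_h_below (by omega) hx, D_h_below (by omega) hx,
        D_v_below (by omega) hx]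
      have e1 : y + 1 + j - y = j + 1 := by omega
      have e2 : y + 1 + j - (y + 1) = j := by omega
      have e3 : y + 1 + j + 1 - y = j + 2 := by omega
      rw [e1, e2, e3]
      exact b_face3 hr hx (hI _ hx) j (by omega)

lemma b_surjOn : Set.SurjOn (TofD n) (DFull n) (ITAFull 4 n) := by
  rintro T ⟨hT, hT0⟩
  have hr : RangeOK n T := fun i j k h1 h2 h3 h4 h5 =>
    Finset.mem_Icc.1 (hT.1 i j k h1 h2 h3 h4 h5)
  have hI : ∀ k, k + 1 ≤ n → RowInter T k := fun k hk => inter_of_ITA hT hk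
  refine ⟨DofT n T, ⟨b_lab hr hI, ?_, ?_, ?_⟩, ?_⟩
  · intro x y h
    simp only [DofT, if_true]
    rw [if_neg h]
  · intro x y h
    simp only [DofT, if_true, one_ne_zero, if_false]
    rw [if_neg h]
  · intro d x y h0 h1
    simp only [DofT, if_neg h0, if_neg h1]
  · funext i j k
    by_cases h : 1 ≤ i ∧ i ≤ 4 ∧ 1 ≤ j ∧ j ≤ k ∧ k ≤ n
    · obtain ⟨h1, h2, h3, h4, h5⟩ := h
      obtain ⟨j, rfl⟩ : ∃ k', j = k' + 1 := ⟨j - 1, by omega⟩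
      rcases four_cases h1 h2 with rfl | rfl | rfl | rfl
      · rw [TofD_one h4 h5, D_v_above (by omega) (by omega), Wd]
        obtain ⟨d, rfl⟩ : ∃ d, k = j + 1 + d := ⟨k - (j + 1), by omega⟩
        exact (b_const1 hr hI j d h5).symm
      · rw [TofD_two h4 h5, D_h_above h4 h5]
      · rw [TofD_three h4 h5, D_v_below (by omega) h5]
        congr 1
        omega
      · obtain ⟨d, rfl⟩ : ∃ d, k = d + 1 + j := ⟨k - (j + 1), by omega⟩
        have e : d + 1 + j - (j + 1) = d := by omega
        rw [TofD_four h4 h5, e, D_h_below (by omega) (by omega), b_const4 hr hI d j (by omega),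
          (b_corner hr (by omega) (hI d (by omega))).1, Nat.sub_zero]
    · rw [hT0 i j k h]
      unfold TofD
      split_ifs <;> first | rfl | omega

end backward

/-- `𝒟'` is a bijection from `𝒟_n` to the interlacing triangular arrays of rank `4`
and height `n`; moreover for each `λ = (λ^(1),…,λ^(4)) ∈ ({1,2,3,4}^n)^4` it restricts
to a bijection from the labelings whose boundary reads `λ` to the arrays with top
row `λ`. -/
theorem TofD_bijection (n : ℕ) (hn : 1 ≤ n) :
    Set.BijOn (TofD n) (DFull n) (ITAFull 4 n) ∧
    ∀ lam : ℕ → ℕ → ℕ,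
      (∀ i j, 1 ≤ i → i ≤ 4 → 1 ≤ j → j ≤ n → lam i j ∈ Finset.Icc 1 4) →
      Set.BijOn (TofD n)
        {D | D ∈ DFull n ∧ ∀ j, 1 ≤ j → j ≤ n →
            D 1 0 (j - 1) = lam 1 j ∧ D 0 (j - 1) n = lam 2 j ∧
            D 1 n (n - j) = lam 3 j ∧ D 0 (n - j) 0 = lam 4 j}
        {T | T ∈ ITAFull 4 n ∧ ∀ i j, 1 ≤ i → i ≤ 4 → 1 ≤ j → j ≤ n →
            T i j n = lam i j} := by

  have hB : Set.BijOn (TofD n) (DFull n) (ITAFull 4 n) := ⟨f_mapsTo, f_injOn, b_surjOn⟩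
  refine ⟨hB, fun lam _ => ?_⟩
  have key : ∀ D, (∀ j, 1 ≤ j → j ≤ n →
      D 1 0 (j - 1) = lam 1 j ∧ D 0 (j - 1) n = lam 2 j ∧
      D 1 n (n - j) = lam 3 j ∧ D 0 (n - j) 0 = lam 4 j) ↔
      (∀ i j, 1 ≤ i → i ≤ 4 → 1 ≤ j → j ≤ n → TofD n D i j n = lam i j) := by
    intro D
    constructor
    · intro h i j h1 h2 h3 h4
      obtain ⟨a1, a2, a3, a4⟩ := h j h3 h4
      rcases four_cases h1 h2 with rfl | rfl | rfl | rfl <;> simpa [TofD, h3, h4]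
    · intro h j h3 h4
      have a1 := h 1 j (by omega) (by omega) h3 h4
      have a2 := h 2 j (by omega) (by omega) h3 h4
      have a3 := h 3 j (by omega) (by omega) h3 h4
      have a4 := h 4 j (by omega) (by omega) h3 h4
      simp [TofD, h3, h4] at a1 a2 a3 a4
      exact ⟨a1, a2, a3, a4⟩
  refine ⟨?_, fun D hD D' hD' h => hB.2.1 hD.1 hD'.1 h, ?_⟩
  · rintro D ⟨hD, hl⟩
    exact ⟨hB.1 hD, (key D).1 hl⟩
  · rintro T ⟨hT, hl⟩
    obtain ⟨D, hD, rfl⟩ := hB.2.2 hT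
    exact ⟨D, ⟨hD, (key D).2 hl⟩, rfl⟩
end

section
/- There exists a positive integer n such that 5 times the number of interlacing triangular arrays of rank 4 and height n is not equal to the number of proper vertex 5-colorings of the graph ⊠_n. (This disproves Conjecture A.5 of Aggarwal–Borodin–Wheeler.) -/
/-- Proper vertex `5`-colorings of the graph `⊠_n`, obtained from the square grid
`□_n` (vertex set `{0,…,n}²`) by adding both diagonals of every unit square face;
colorings use colors `{0,1,2,3,4}` and are normalized to `0` outside the vertex set. -/
def BoxColorFull (n : ℕ) : Set (ℕ × ℕ → ℕ) :=
  {C | (∀ x y, x ≤ n → y ≤ n → C (x, y) < 5) ∧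
       (∀ x y, x < n → y ≤ n → C (x, y) ≠ C (x + 1, y)) ∧
       (∀ x y, x ≤ n → y < n → C (x, y) ≠ C (x, y + 1)) ∧
       (∀ x y, x < n → y < n →
          C (x, y) ≠ C (x + 1, y + 1) ∧ C (x + 1, y) ≠ C (x, y + 1)) ∧
       (∀ x y, ¬(x ≤ n ∧ y ≤ n) → C (x, y) = 0)}

/-! ### Upper bound for the number of colorings of the `4 × 4` king graph -/

/-- rows compatible with a given neighbouring row -/
def nextRows (r : ℕ × ℕ × ℕ × ℕ) : List (ℕ × ℕ × ℕ × ℕ) :=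
  (([0, 1, 2, 3, 4] : List ℕ).filter fun e => !(Nat.beq e r.1) && !(Nat.beq e r.2.1)).flatMap fun e =>
  (([0, 1, 2, 3, 4] : List ℕ).filter fun f => !(Nat.beq f r.1) && !(Nat.beq f r.2.1) &&
    !(Nat.beq f r.2.2.1) && !(Nat.beq f e)).flatMap fun f =>
  (([0, 1, 2, 3, 4] : List ℕ).filter fun g => !(Nat.beq g r.2.1) && !(Nat.beq g r.2.2.1) &&
    !(Nat.beq g r.2.2.2) && !(Nat.beq g f)).flatMap fun g =>
  (([0, 1, 2, 3, 4] : List ℕ).filter fun h => !(Nat.beq h r.2.2.1) && !(Nat.beq h r.2.2.2) &&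
    !(Nat.beq h g)).map fun h => (e, f, g, h)

/-- proper rows -/
def allRows : List (ℕ × ℕ × ℕ × ℕ) :=
  ([0, 1, 2, 3, 4] : List ℕ).flatMap fun e =>
  (([0, 1, 2, 3, 4] : List ℕ).filter fun f => !(Nat.beq f e)).flatMap fun f =>
  (([0, 1, 2, 3, 4] : List ℕ).filter fun g => !(Nat.beq g f)).flatMap fun g =>
  (([0, 1, 2, 3, 4] : List ℕ).filter fun h => !(Nat.beq h g)).map fun h => (e, f, g, h)

/-- all colorings, as (second row, third row, first row, fourth row) -/
def allCol : List ((ℕ × ℕ × ℕ × ℕ) × (ℕ × ℕ × ℕ × ℕ) × (ℕ × ℕ × ℕ × ℕ) × (ℕ × ℕ × ℕ × ℕ)) :=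
  allRows.flatMap fun r2 => (nextRows r2).flatMap fun r3 =>
    (nextRows r2).flatMap fun r1 => (nextRows r3).map fun r4 => (r2, r3, r1, r4)

theorem allCol_count :
    (allRows.map fun r => (nextRows r).length *
      ((nextRows r).map fun s => (nextRows s).length).sum).sum = 935040 := by
  decide +kernel

theorem sum_map_const_mul {α : Type*} (l : List α) (f : α → ℕ) (c : ℕ) :
    (l.map fun x => c * f x).sum = c * (l.map f).sum := by
  induction l with
  | nil => simp
  | cons a l ih => simp [ih, mul_add]

theorem allCol_length : allCol.length = 935040 := by
  rw [← allCol_count]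
  simp only [allCol, List.length_flatMap, List.length_map, List.map_const', List.sum_replicate,
    smul_eq_mul, sum_map_const_mul]

theorem mem_five {x : ℕ} : x ∈ ([0, 1, 2, 3, 4] : List ℕ) ↔ x < 5 := by
  simp only [List.mem_cons, List.not_mem_nil, or_false]; omega

theorem beq_false_iff (x y : ℕ) : (!(Nat.beq x y)) = true ↔ x ≠ y := by
  have h := @Nat.beq_eq x y
  cases hb : Nat.beq x y <;> simp_all

theorem mem_nextRows {a b c d e f g h : ℕ} : (e, f, g, h) ∈ nextRows (a, b, c, d) ↔
    (e < 5 ∧ e ≠ a ∧ e ≠ b) ∧ (f < 5 ∧ ((f ≠ a ∧ f ≠ b) ∧ f ≠ c) ∧ f ≠ e) ∧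
    (g < 5 ∧ ((g ≠ b ∧ g ≠ c) ∧ g ≠ d) ∧ g ≠ f) ∧ (h < 5 ∧ (h ≠ c ∧ h ≠ d) ∧ h ≠ g) := by
  simp only [nextRows, List.mem_flatMap, List.mem_map, List.mem_filter, mem_five,
    Bool.and_eq_true, beq_false_iff, Prod.mk.injEq]
  constructor
  · rintro ⟨e', he, f', hf, g', hg, h', hh, rfl, rfl, rfl, rfl⟩
    exact ⟨he, hf, hg, hh⟩
  · rintro ⟨he, hf, hg, hh⟩
    exact ⟨e, he, f, hf, g, hg, h, hh, rfl, rfl, rfl, rfl⟩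

theorem mem_allRows {e f g h : ℕ} : (e, f, g, h) ∈ allRows ↔
    e < 5 ∧ (f < 5 ∧ f ≠ e) ∧ (g < 5 ∧ g ≠ f) ∧ (h < 5 ∧ h ≠ g) := by
  simp only [allRows, List.mem_flatMap, List.mem_map, List.mem_filter, mem_five,
    beq_false_iff, Prod.mk.injEq]
  constructor
  · rintro ⟨e', he, f', hf, g', hg, h', hh, rfl, rfl, rfl, rfl⟩
    exact ⟨he, hf, hg, hh⟩
  · rintro ⟨he, hf, hg, hh⟩
    exact ⟨e, he, f, hf, g, hg, h, hh, rfl, rfl, rfl, rfl⟩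

/-- row `y` of a coloring -/
def rowOf (C : ℕ × ℕ → ℕ) (y : ℕ) : ℕ × ℕ × ℕ × ℕ := (C (0, y), C (1, y), C (2, y), C (3, y))

theorem box_le : (BoxColorFull 3).ncard ≤ 935040 := by
  classical
  have h1 : (BoxColorFull 3).ncard ≤ ((allCol.toFinset : Finset _) : Set ((ℕ × ℕ × ℕ × ℕ) ×
      (ℕ × ℕ × ℕ × ℕ) × (ℕ × ℕ × ℕ × ℕ) × (ℕ × ℕ × ℕ × ℕ))).ncard := by
    refine Set.ncard_le_ncard_of_injOn
      (fun C => (rowOf C 1, rowOf C 2, rowOf C 0, rowOf C 3)) ?_ ?_ (Finset.finite_toSet _)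
    · rintro C ⟨hr, hx, hy, hd, -⟩
      have key : ∀ y, y < 3 → rowOf C (y+1) ∈ nextRows (rowOf C y) ∧
          rowOf C y ∈ nextRows (rowOf C (y+1)) := by
        intro y hy3
        have a0 := hr 0 y (by omega) (by omega)
        have a1 := hr 0 (y+1) (by omega) (by omega)
        have a2 := hr 1 y (by omega) (by omega)
        have a3 := hr 1 (y+1) (by omega) (by omega)
        have a4 := hr 2 y (by omega) (by omega)
        have a5 := hr 2 (y+1) (by omega) (by omega)
        have a6 := hr 3 y (by omega) (by omega)
        have a7 := hr 3 (y+1) (by omega) (by omega)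
        have a8 : C (0, y) ≠ C (1, y) := hx 0 y (by omega) (by omega)
        have a9 : C (0, y+1) ≠ C (1, y+1) := hx 0 (y+1) (by omega) (by omega)
        have a10 : C (1, y) ≠ C (2, y) := hx 1 y (by omega) (by omega)
        have a11 : C (1, y+1) ≠ C (2, y+1) := hx 1 (y+1) (by omega) (by omega)
        have a12 : C (2, y) ≠ C (3, y) := hx 2 y (by omega) (by omega)
        have a13 : C (2, y+1) ≠ C (3, y+1) := hx 2 (y+1) (by omega) (by omega)
        have a14 : C (0, y) ≠ C (0, y+1) := hy 0 y (by omega) (by omega)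
        have a15 : C (1, y) ≠ C (1, y+1) := hy 1 y (by omega) (by omega)
        have a16 : C (2, y) ≠ C (2, y+1) := hy 2 y (by omega) (by omega)
        have a17 : C (3, y) ≠ C (3, y+1) := hy 3 y (by omega) (by omega)
        have a18 : C (0, y) ≠ C (1, y+1) := (hd 0 y (by omega) (by omega)).1
        have a19 : C (1, y) ≠ C (0, y+1) := (hd 0 y (by omega) (by omega)).2
        have a20 : C (1, y) ≠ C (2, y+1) := (hd 1 y (by omega) (by omega)).1
        have a21 : C (2, y) ≠ C (1, y+1) := (hd 1 y (by omega) (by omega)).2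
        have a22 : C (2, y) ≠ C (3, y+1) := (hd 2 y (by omega) (by omega)).1
        have a23 : C (3, y) ≠ C (2, y+1) := (hd 2 y (by omega) (by omega)).2
        clear hr hx hy hd
        simp only [rowOf, mem_nextRows]
        refine ⟨⟨⟨?_, ?_, ?_⟩, ⟨?_, ⟨⟨?_, ?_⟩, ?_⟩, ?_⟩, ⟨?_, ⟨⟨?_, ?_⟩, ?_⟩, ?_⟩, ?_, ⟨?_, ?_⟩, ?_⟩,
          ⟨?_, ?_, ?_⟩, ⟨?_, ⟨⟨?_, ?_⟩, ?_⟩, ?_⟩, ⟨?_, ⟨⟨?_, ?_⟩, ?_⟩, ?_⟩, ?_, ⟨?_, ?_⟩, ?_⟩ <;>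
          with_reducible first | assumption | (apply Ne.symm; assumption)
      have k0 : rowOf C 1 ∈ allRows := by
        simp only [rowOf, mem_allRows]
        exact ⟨hr 0 1 (by omega) (by omega),
          ⟨hr 1 1 (by omega) (by omega), (hx 0 1 (by omega) (by omega)).symm⟩,
          ⟨hr 2 1 (by omega) (by omega), (hx 1 1 (by omega) (by omega)).symm⟩,
          hr 3 1 (by omega) (by omega), (hx 2 1 (by omega) (by omega)).symm⟩
      simp only [List.coe_toFinset, Set.mem_setOf_eq, allCol, List.mem_flatMap, List.mem_map]
      exact ⟨_, k0, _, (key 1 (by omega)).1, _, (key 0 (by omega)).2, _, (key 2 (by omega)).1, rfl⟩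
    · rintro C ⟨-, -, -, -, hC⟩ D ⟨-, -, -, -, hD⟩ h
      simp only [rowOf, Prod.mk.injEq] at h
      funext ⟨x, y⟩
      by_cases hxy : x ≤ 3 ∧ y ≤ 3
      · obtain ⟨hx, hy⟩ := hxy
        interval_cases x <;> interval_cases y <;> tauto
      · rw [hC x y hxy, hD x y hxy]
  rw [Set.ncard_coe_finset] at h1
  exact h1.trans ((List.toFinset_card_le _).trans allCol_length.le)

/-! ### Lower bound for the number of arrays -/

/-- all ways to insert a row above `w`, starting from the set of open letters `S` (a bit mask),
together with the final set of open letters -/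
def extRow : List ℕ → ℕ → List (List ℕ × ℕ)
  | [], S => (([1, 2, 3, 4] : List ℕ).filter fun a => !(Nat.testBit S a)).map
      fun a => ([a], S ^^^ (2 ^ a))
  | b :: w, S => (([1, 2, 3, 4] : List ℕ).filter fun a => !(Nat.testBit S a) &&
        Nat.testBit (S ^^^ (2 ^ a)) b).flatMap
      fun a => (extRow w ((S ^^^ (2 ^ a)) ^^^ (2 ^ b))).map fun e => (a :: e.1, e.2)

/-- new letters of the first two blocks in a row, ending with open letters `S` -/
def half (w : List ℕ) (S : ℕ) : List (ℕ × List ℕ) :=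
  ([1, 2, 3, 4] : List ℕ).flatMap fun c =>
    ((extRow w (2 ^ c)).filter fun e => Nat.beq e.2 S).map fun e => (c, e.1)

/-- the left half of an array -/
abbrev HalfData := (ℕ × List ℕ) × (ℕ × List ℕ) × (ℕ × List ℕ)

def halves (S1 S2 S3 : ℕ) : List HalfData :=
  (half [] S1).flatMap fun e1 => (half e1.2 S2).flatMap fun e2 =>
    (half e2.2 S3).map fun e3 => (e1, e2, e3)

def halfCount (S1 S2 S3 : ℕ) : ℕ :=
  ((half [] S1).map fun e1 => ((half e1.2 S2).map fun e2 => (half e2.2 S3).length).sum).sum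

def masks : List ℕ := [6, 10, 18, 12, 20, 24]

def pairsList : List (HalfData × HalfData) :=
  masks.flatMap fun S1 => masks.flatMap fun S2 => masks.flatMap fun S3 =>
    (halves S1 S2 S3).flatMap fun l => (halves (30 - S1) (30 - S2) (30 - S3)).map fun r => (l, r)

theorem pairs_count :
    (masks.map fun S1 => (masks.map fun S2 => (masks.map fun S3 =>
      halfCount S1 S2 S3 * halfCount (30 - S1) (30 - S2) (30 - S3)).sum).sum).sum = 191232 := by
  decide +kernel

theorem pairs_length : pairsList.length = 191232 := by
  rw [← pairs_count]
  have h : ∀ S1 S2 S3, (halves S1 S2 S3).length = halfCount S1 S2 S3 := by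
    intro S1 S2 S3
    simp only [halves, halfCount, List.length_flatMap, List.length_map]
  simp only [pairsList, List.length_flatMap, List.length_map, List.map_const', List.sum_replicate,
    smul_eq_mul, h]

theorem extRow_unique {w : List ℕ} : ∀ {S : ℕ} {v : List ℕ} {T T' : ℕ},
    (v, T) ∈ extRow w S → (v, T') ∈ extRow w S → T = T' := by
  induction w with
  | nil =>
    intro S v T T' h h'
    simp only [extRow, List.mem_map, List.mem_filter, Prod.mk.injEq] at h h'
    obtain ⟨a, -, rfl, rfl⟩ := h
    obtain ⟨a', -, h1, rfl⟩ := h'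
    simp only [List.cons.injEq, and_true] at h1
    rw [h1]
  | cons b w ih =>
    intro S v T T' h h'
    simp only [extRow, List.mem_map, List.mem_flatMap, Prod.mk.injEq] at h h'
    obtain ⟨a, -, ⟨v1, T1⟩, h1, rfl, rfl⟩ := h
    obtain ⟨a', -, ⟨v2, T2⟩, h2, h3, rfl⟩ := h'
    simp only [List.cons.injEq] at h3
    obtain ⟨rfl, rfl⟩ := h3
    exact ih h1 h2

theorem extRow_nodup (w : List ℕ) : ∀ S, (extRow w S).Nodup := by
  induction w with
  | nil =>
    intro S
    refine List.Nodup.map ?_ (List.Nodup.filter _ (by decide))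
    intro a b h
    simpa using congrArg Prod.fst h
  | cons b w ih =>
    intro S
    rw [extRow, List.nodup_flatMap]
    refine ⟨fun a _ => List.Nodup.map ?_ (ih _), ?_⟩
    · rintro ⟨u, U⟩ ⟨v, V⟩ h
      simpa using h
    · refine List.Pairwise.imp ?_ (List.Nodup.filter _ (by decide : ([1, 2, 3, 4] : List ℕ).Nodup))
      intro a c hac
      simp only [Function.onFun, List.disjoint_left, List.mem_map]
      rintro _ ⟨e, -, rfl⟩ ⟨f, -, hf⟩
      simp only [Prod.mk.injEq, List.cons.injEq] at hf
      exact hac hf.1.1.symm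

theorem mem_half {w : List ℕ} {S : ℕ} {e : ℕ × List ℕ} :
    e ∈ half w S ↔ e.1 ∈ ([1, 2, 3, 4] : List ℕ) ∧ (e.2, S) ∈ extRow w (2 ^ e.1) := by
  simp only [half, List.mem_flatMap, List.mem_map, List.mem_filter, Nat.beq_eq]
  constructor
  · rintro ⟨c, hc, ⟨v, T⟩, ⟨h1, rfl⟩, rfl⟩
    exact ⟨hc, h1⟩
  · rintro ⟨h1, h2⟩
    exact ⟨e.1, h1, (e.2, S), ⟨h2, rfl⟩, rfl⟩

theorem half_nodup (w : List ℕ) (S : ℕ) : (half w S).Nodup := by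
  rw [half, List.nodup_flatMap]
  refine ⟨fun c _ => List.Nodup.map_on ?_ (List.Nodup.filter _ (extRow_nodup _ _)), ?_⟩
  · rintro ⟨u, U⟩ hu ⟨v, V⟩ hv h
    simp only [List.mem_filter, Nat.beq_eq] at hu hv
    simp only [Prod.mk.injEq, true_and] at h
    rw [h, hu.2, hv.2]
  · refine List.Pairwise.imp ?_ (by decide : ([1, 2, 3, 4] : List ℕ).Nodup)
    intro a c hac
    simp only [Function.onFun, List.disjoint_left, List.mem_map]
    rintro _ ⟨e, -, rfl⟩ ⟨f, -, hf⟩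
    simp only [Prod.mk.injEq] at hf
    exact hac hf.1.symm

theorem mem_halves {S1 S2 S3 : ℕ} {l : HalfData} : l ∈ halves S1 S2 S3 ↔
    l.1 ∈ half [] S1 ∧ l.2.1 ∈ half l.1.2 S2 ∧ l.2.2 ∈ half l.2.1.2 S3 := by
  simp only [halves, List.mem_flatMap, List.mem_map]
  constructor
  · rintro ⟨e1, h1, e2, h2, e3, h3, rfl⟩
    exact ⟨h1, h2, h3⟩
  · rintro ⟨h1, h2, h3⟩
    exact ⟨_, h1, _, h2, _, h3, rfl⟩

theorem halves_unique {S1 S2 S3 T1 T2 T3 : ℕ} {l : HalfData}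
    (h : l ∈ halves S1 S2 S3) (h' : l ∈ halves T1 T2 T3) : S1 = T1 ∧ S2 = T2 ∧ S3 = T3 := by
  simp only [mem_halves, mem_half] at h h'
  exact ⟨extRow_unique h.1.2 h'.1.2, extRow_unique h.2.1.2 h'.2.1.2, extRow_unique h.2.2.2 h'.2.2.2⟩

theorem halves_nodup (S1 S2 S3 : ℕ) : (halves S1 S2 S3).Nodup := by
  rw [halves, List.nodup_flatMap]
  refine ⟨fun e _ => ?_, ?_⟩
  · rw [List.nodup_flatMap]
    refine ⟨fun f _ => List.Nodup.map ?_ (half_nodup _ _), ?_⟩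
    · intro x y h
      simpa using h
    · refine List.Pairwise.imp ?_ (half_nodup _ _)
      intro a c hac
      simp only [Function.onFun, List.disjoint_left, List.mem_map]
      rintro _ ⟨x, -, rfl⟩ ⟨y, -, hf⟩
      simp only [Prod.mk.injEq] at hf
      exact hac hf.2.1.symm
  · refine List.Pairwise.imp ?_ (half_nodup _ _)
    intro a c hac
    simp only [Function.onFun, List.disjoint_left, List.mem_map, List.mem_flatMap]
    rintro _ ⟨x, -, x', -, rfl⟩ ⟨y, -, y', -, hf⟩
    simp only [Prod.mk.injEq] at hf
    exact hac hf.1.symm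

theorem pairs_mem {t : HalfData × HalfData} : t ∈ pairsList ↔
    ∃ S1 ∈ masks, ∃ S2 ∈ masks, ∃ S3 ∈ masks,
      t.1 ∈ halves S1 S2 S3 ∧ t.2 ∈ halves (30 - S1) (30 - S2) (30 - S3) := by
  simp only [pairsList, List.mem_flatMap, List.mem_map]
  constructor
  · rintro ⟨S1, h1, S2, h2, S3, h3, l, hl, r, hr, rfl⟩
    exact ⟨S1, h1, S2, h2, S3, h3, hl, hr⟩
  · rintro ⟨S1, h1, S2, h2, S3, h3, hl, hr⟩
    exact ⟨S1, h1, S2, h2, S3, h3, _, hl, _, hr, rfl⟩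

theorem pairs_nodup : pairsList.Nodup := by
  have hm : masks.Nodup := by decide
  rw [pairsList, List.nodup_flatMap]
  refine ⟨fun S1 _ => ?_, ?_⟩
  · rw [List.nodup_flatMap]
    refine ⟨fun S2 _ => ?_, ?_⟩
    · rw [List.nodup_flatMap]
      refine ⟨fun S3 _ => ?_, ?_⟩
      · rw [List.nodup_flatMap]
        refine ⟨fun l _ => List.Nodup.map ?_ (halves_nodup _ _ _), ?_⟩
        · intro x y h
          simpa using h
        · refine List.Pairwise.imp ?_ (halves_nodup _ _ _)
          intro a c hac
          simp only [Function.onFun, List.disjoint_left, List.mem_map]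
          rintro _ ⟨x, -, rfl⟩ ⟨y, -, hf⟩
          simp only [Prod.mk.injEq] at hf
          exact hac hf.1.symm
      · refine List.Pairwise.imp ?_ hm
        intro a c hac
        simp only [Function.onFun, List.disjoint_left, List.mem_map, List.mem_flatMap]
        rintro _ ⟨x, hx, x', -, rfl⟩ ⟨y, hy, y', -, hf⟩
        simp only [Prod.mk.injEq] at hf
        rw [hf.1] at hy
        exact hac (halves_unique hx hy).2.2
    · refine List.Pairwise.imp ?_ hm
      intro a c hac
      simp only [Function.onFun, List.disjoint_left, List.mem_map, List.mem_flatMap]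
      rintro _ ⟨_, -, x, hx, x', -, rfl⟩ ⟨_, -, y, hy, y', -, hf⟩
      simp only [Prod.mk.injEq] at hf
      rw [hf.1] at hy
      exact hac (halves_unique hx hy).2.1
  · refine List.Pairwise.imp ?_ hm
    intro a c hac
    simp only [Function.onFun, List.disjoint_left, List.mem_map, List.mem_flatMap]
    rintro _ ⟨_, -, _, -, x, hx, x', -, rfl⟩ ⟨_, -, _, -, y, hy, y', -, hf⟩
    simp only [Prod.mk.injEq] at hf
    rw [hf.1] at hy
    exact hac (halves_unique hx hy).1

/-- alternation automaton for the letter `a` on a merged pair of rows -/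
def scan (a : ℕ) : Bool → List (Bool × ℕ) → Option Bool
  | s, [] => some s
  | s, (b, x) :: L => if x = a then (if b = s then none else scan a b L) else scan a s L

theorem scan_append (a : ℕ) (L M : List (Bool × ℕ)) :
    ∀ {s t : Bool}, scan a s L = some t → scan a s (L ++ M) = scan a t M := by
  induction L with
  | nil => intro s t h; simp only [scan, Option.some.injEq] at h; simp [h]
  | cons p L ih =>
    obtain ⟨b, x⟩ := p
    intro s t h
    simp only [scan, List.cons_append] at h ⊢
    split_ifs at h ⊢
    · exact ih h
    · exact ih h

theorem scan_reverse (a : ℕ) (L : List (Bool × ℕ)) :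
    ∀ {s t : Bool}, scan a s L = some t → scan a (!t) L.reverse = some (!s) := by
  induction L with
  | nil => intro s t h; simp only [scan, Option.some.injEq] at h; simp [h, scan]
  | cons p L ih =>
    obtain ⟨b, x⟩ := p
    intro s t h
    simp only [scan] at h
    rw [List.reverse_cons]
    split_ifs at h with h1 h2
    · rw [scan_append a _ _ (ih h)]
      cases b <;> cases s <;> simp_all [scan]
    · rw [scan_append a _ _ (ih h)]
      simp [scan, h1]

theorem scan_count (a : ℕ) (L : List (Bool × ℕ)) :
    ∀ {s t : Bool}, scan a s L = some t →
      L.count (true, a) + s.toNat = L.count (false, a) + t.toNat := by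
  induction L with
  | nil => intro s t h; simp only [scan, Option.some.injEq] at h; simp [h]
  | cons p L ih =>
    obtain ⟨b, x⟩ := p
    intro s t h
    simp only [scan] at h
    split_ifs at h with h1 h2
    · have := ih h
      cases b <;> cases s <;> simp_all <;> omega
    · have := ih h
      simpa [List.count_cons, h1] using this

theorem scan_first (a : ℕ) (L : List (ℤ × Bool × ℕ)) :
    ∀ {t : Bool}, L.Pairwise (fun p q => p.1 < q.1) → scan a true (L.map Prod.snd) = some t →
      ∀ h, (h, true, a) ∈ L → ∃ h', (h', false, a) ∈ L ∧ h' < h := by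
  induction L with
  | nil => intro t _ _ h hh; simp at hh
  | cons p L ih =>
    obtain ⟨g, b, x⟩ := p
    intro t hp hs h hh
    rw [List.pairwise_cons] at hp
    simp only [List.map_cons, scan] at hs
    split_ifs at hs with h1 h2
    · subst h1
      have hb : b = false := by simpa using h2
      subst hb
      rcases List.mem_cons.1 hh with h3 | h3
      · simp at h3
      · exact ⟨g, by simp, hp.1 _ h3⟩
    · rcases List.mem_cons.1 hh with h3 | h3
      · simp only [Prod.mk.injEq] at h3
        exact absurd h3.2.2.symm h1
      · obtain ⟨h', h4, h5⟩ := ih hp.2 hs h h3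
        exact ⟨h', List.mem_cons_of_mem _ h4, h5⟩

theorem scan_between (a : ℕ) (L : List (ℤ × Bool × ℕ)) :
    ∀ {s t : Bool}, L.Pairwise (fun p q => p.1 < q.1) → scan a s (L.map Prod.snd) = some t →
      ∀ g h, (g, true, a) ∈ L → (h, true, a) ∈ L → g < h →
        ∃ h', (h', false, a) ∈ L ∧ g < h' ∧ h' < h := by
  induction L with
  | nil => intro s t _ _ g h hh; simp at hh
  | cons p L ih =>
    obtain ⟨f, b, x⟩ := p
    intro s t hp hs g h hg hh hgh
    rw [List.pairwise_cons] at hp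
    simp only [List.map_cons, scan] at hs
    rcases List.mem_cons.1 hh with hh | hh
    · simp only [Prod.mk.injEq] at hh
      rcases List.mem_cons.1 hg with hg | hg
      · simp only [Prod.mk.injEq] at hg
        omega
      · have := hp.1 _ hg
        simp only at this
        omega
    · rename' hh => hh2
      rcases List.mem_cons.1 hg with hg | hg
      · simp only [Prod.mk.injEq] at hg
        obtain ⟨rfl, rfl, rfl⟩ := hg
        rw [if_pos rfl] at hs
        split_ifs at hs
        obtain ⟨h', h4, h5⟩ := scan_first a L hp.2 hs h hh2
        exact ⟨h', List.mem_cons_of_mem _ h4, hp.1 _ h4, h5⟩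
      · have key : ∃ s', scan a s' (L.map Prod.snd) = some t := by
          split_ifs at hs
          · exact ⟨_, hs⟩
          · exact ⟨_, hs⟩
        obtain ⟨s', hs'⟩ := key
        obtain ⟨h', h4, h5⟩ := ih hp.2 hs' g h hg hh2 hgh
        exact ⟨h', List.mem_cons_of_mem _ h4, h5⟩

/-- merge of an upper row and a lower row -/
def inter : List ℕ → List ℕ → List (Bool × ℕ)
  | p :: v, u :: w => (true, p) :: (false, u) :: inter v w
  | p :: _, [] => [(true, p)]
  | [], _ => []

theorem extRow_spec {w : List ℕ} : ∀ {S : ℕ} {v : List ℕ} {T : ℕ}, (v, T) ∈ extRow w S →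
    v.length = w.length + 1 ∧ (∀ a ∈ v, a ∈ ([1, 2, 3, 4] : List ℕ)) ∧
    ∀ a, scan a (S.testBit a) (inter v w) = some (T.testBit a) := by
  induction w with
  | nil =>
    intro S v T h
    simp only [extRow, List.mem_map, List.mem_filter, Prod.mk.injEq] at h
    obtain ⟨x, ⟨hx, hx2⟩, rfl, rfl⟩ := h
    refine ⟨rfl, by simpa using hx, fun a => ?_⟩
    simp only [inter, scan, Nat.testBit_xor, Nat.testBit_two_pow]
    by_cases h : x = a
    · subst h; simp_all
    · simp [h]
  | cons b w ih =>
    intro S v T h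
    simp only [extRow, List.mem_map, List.mem_flatMap, List.mem_filter, Prod.mk.injEq,
      Bool.and_eq_true] at h
    obtain ⟨x, ⟨hx, hx1, hx2⟩, ⟨v1, T1⟩, h1, rfl, rfl⟩ := h
    obtain ⟨i1, i2, i3⟩ := ih h1
    refine ⟨by simp [i1], ?_, fun a => ?_⟩
    · intro a ha
      rcases List.mem_cons.1 ha with rfl | ha
      · exact hx
      · exact i2 a ha
    · have h3 := i3 a
      simp only [inter, scan]
      simp only [Nat.testBit_xor, Nat.testBit_two_pow] at h3 hx2
      by_cases h : x = a
      · subst h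
        by_cases h' : b = x
        · subst h'; simp_all
        · have : ¬ x = b := fun h => h' h.symm
          simp_all
      · by_cases h' : b = a
        · subst h'; simp_all
        · simp_all

theorem mem_four {x : ℕ} (h : x ∈ ([1, 2, 3, 4] : List ℕ)) : 1 ≤ x ∧ x ≤ 4 := by
  simp only [List.mem_cons, List.not_mem_nil, or_false] at h; omega

theorem halves_spec {S1 S2 S3 : ℕ} {l : HalfData} (h : l ∈ halves S1 S2 S3) :
    ∃ c1 d c2 x y c3 p q s : ℕ, l = ((c1, [d]), (c2, [x, y]), (c3, [p, q, s])) ∧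
      (∀ a ∈ [c1, d, c2, x, y, c3, p, q, s], 1 ≤ a ∧ a ≤ 4) ∧
      (∀ a, scan a false [(true, c1), (true, d)] = some (S1.testBit a)) ∧
      (∀ a, scan a false [(true, c1), (false, c1), (true, c2), (true, x), (false, d), (true, y)]
        = some (S2.testBit a)) ∧
      (∀ a, scan a false [(true, c1), (false, c1), (true, c2), (false, c2), (true, c3),
        (true, p), (false, x), (true, q), (false, y), (true, s)] = some (S3.testBit a)) := by
  obtain ⟨⟨c1, w1⟩, ⟨c2, w2⟩, ⟨c3, w3⟩⟩ := l
  simp only [mem_halves, mem_half] at h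
  obtain ⟨⟨hc1, h1⟩, ⟨hc2, h2⟩, hc3, h3⟩ := h
  obtain ⟨l1, m1, r1⟩ := extRow_spec h1
  obtain ⟨l2, m2, r2⟩ := extRow_spec h2
  obtain ⟨l3, m3, r3⟩ := extRow_spec h3
  simp only [List.length_nil, zero_add] at l1
  rw [l1] at l2
  rw [l2] at l3
  obtain ⟨d, rfl⟩ := List.length_eq_one_iff.1 l1
  obtain ⟨x, y, rfl⟩ := List.length_eq_two.1 l2
  obtain ⟨p, q, s, rfl⟩ := List.length_eq_three.1 l3
  refine ⟨c1, d, c2, x, y, c3, p, q, s, rfl, ?_, ?_, ?_, ?_⟩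
  · simp only [List.mem_cons, List.not_mem_nil, or_false, forall_eq_or_imp, forall_eq]
    exact ⟨mem_four hc1, mem_four (m1 _ (by simp)), mem_four hc2, mem_four (m2 _ (by simp)),
      mem_four (m2 _ (by simp)), mem_four hc3, mem_four (m3 _ (by simp)),
      mem_four (m3 _ (by simp)), mem_four (m3 _ (by simp))⟩
  · intro a
    have h := r1 a
    simp only [inter, Nat.testBit_two_pow] at h
    rw [← h]
    by_cases h1 : c1 = a <;> simp [scan, h1]
  · intro a
    have h := r2 a
    simp only [inter, Nat.testBit_two_pow] at h
    rw [← h]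
    by_cases h1 : c1 = a <;> by_cases h2 : c2 = a <;> simp [scan, h1, h2]
  · intro a
    have h := r3 a
    simp only [inter, Nat.testBit_two_pow] at h
    rw [← h]
    by_cases h1 : c1 = a <;> by_cases h2 : c2 = a <;> by_cases h3 : c3 = a <;>
      simp [scan, h1, h2, h3]

theorem glue {a S : ℕ} (ha1 : 1 ≤ a) (ha4 : a ≤ 4) (hS : S ∈ masks) {L R : List (Bool × ℕ)}
    (hL : scan a false L = some (S.testBit a)) (hR : scan a false R = some ((30 - S).testBit a)) :
    scan a false (L ++ R.reverse) = some true := by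
  rw [scan_append a _ _ hL]
  have h := scan_reverse a _ hR
  have e : (!((30 - S).testBit a)) = S.testBit a := by
    have : ∀ S ∈ masks, ∀ a ∈ ([1, 2, 3, 4] : List ℕ), (!((30 - S).testBit a)) = S.testBit a := by
      decide
    refine this S hS a ?_
    simp only [List.mem_cons, List.not_mem_nil, or_false]; omega
  rw [e] at h
  exact h

/-- row-end letters of the outer block -/
def outer (l : HalfData) (j : ℕ) : ℕ := if j = 1 then l.1.1 else if j = 2 then l.2.1.1 else l.2.2.1

/-- rows of the inner block -/
def inner' (l : HalfData) (k : ℕ) : List ℕ :=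
  if k = 1 then l.1.2 else if k = 2 then l.2.1.2 else l.2.2.2

/-- the array built from two halves -/
def mkT (t : HalfData × HalfData) (i j k : ℕ) : ℕ :=
  if 1 ≤ i ∧ i ≤ 4 ∧ 1 ≤ j ∧ j ≤ k ∧ k ≤ 3 then
    if i = 1 then outer t.1 j
    else if i = 2 then (inner' t.1 k).getD (j - 1) 0
    else if i = 3 then (inner' t.2 k).getD (k - j) 0
    else outer t.2 (k + 1 - j)
  else 0

theorem mkT_mem {t : HalfData × HalfData} (ht : t ∈ pairsList) : mkT t ∈ ITAFull 4 3 := by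
  obtain ⟨S1, hS1, S2, hS2, S3, hS3, hl, hr⟩ := pairs_mem.1 ht
  obtain ⟨l, r⟩ := t
  obtain ⟨c1, d, c2, x, y, c3, p, q, s, rfl, m, s1, s2, s3⟩ := halves_spec hl
  obtain ⟨c1', d', c2', x', y', c3', p', q', s', rfl, m', s1', s2', s3'⟩ := halves_spec hr
  clear hl hr ht
  simp only [List.mem_cons, List.not_mem_nil, or_false, forall_eq_or_imp, forall_eq] at m m'
  have g1 := fun a ha1 ha4 => glue (a := a) ha1 ha4 hS1 (s1 a) (s1' a)
  have g2 := fun a ha1 ha4 => glue (a := a) ha1 ha4 hS2 (s2 a) (s2' a)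
  have g3 := fun a ha1 ha4 => glue (a := a) ha1 ha4 hS3 (s3 a) (s3' a)
  clear s1 s2 s3 s1' s2' s3' hS1 hS2 hS3
  simp only [List.reverse_cons, List.reverse_nil, List.nil_append, List.cons_append] at g1 g2 g3
  have hrange : ∀ i j k, 1 ≤ i → i ≤ 4 → 1 ≤ j → j ≤ k → k ≤ 3 →
      mkT (((c1, [d]), (c2, [x, y]), (c3, [p, q, s])),
        ((c1', [d']), (c2', [x', y']), (c3', [p', q', s']))) i j k ∈ Finset.Icc 1 4 := by
    intro i j k hi1 hi4 hj hjk hk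
    rw [Finset.mem_Icc]
    have hj3 : j ≤ 3 := by omega
    interval_cases k <;> interval_cases j <;> interval_cases i <;>
      simp [mkT, outer, inner'] <;> omega
  have h1 : ∀ (k a : ℕ), Finset.card ((Finset.Icc 1 4 ×ˢ Finset.Icc 1 k).filter (fun u : ℕ × ℕ =>
      mkT (((c1, [d]), (c2, [x, y]), (c3, [p, q, s])),
        ((c1', [d']), (c2', [x', y']), (c3', [p', q', s']))) u.1 u.2 k = a)) =
      ∑ i ∈ Finset.Icc 1 4, ∑ j ∈ Finset.Icc 1 k, if mkT (((c1, [d]), (c2, [x, y]), (c3, [p, q, s])),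
        ((c1', [d']), (c2', [x', y']), (c3', [p', q', s']))) i j k = a then 1 else 0 := by
    intro k a
    rw [Finset.card_filter, Finset.sum_product]
  have e4 : ∀ f : ℕ → ℕ, ∑ i ∈ Finset.Icc 1 4, f i = f 1 + f 2 + f 3 + f 4 := by
    intro f; rw [(by decide : Finset.Icc 1 4 = ({1, 2, 3, 4} : Finset ℕ))]; simp [add_assoc]
  have e3 : ∀ f : ℕ → ℕ, ∑ i ∈ Finset.Icc 1 3, f i = f 1 + f 2 + f 3 := by
    intro f; rw [(by decide : Finset.Icc 1 3 = ({1, 2, 3} : Finset ℕ))]; simp [add_assoc]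
  have e2 : ∀ f : ℕ → ℕ, ∑ i ∈ Finset.Icc 1 2, f i = f 1 + f 2 := by
    intro f; rw [(by decide : Finset.Icc 1 2 = ({1, 2} : Finset ℕ))]; simp
  have e1 : ∀ f : ℕ → ℕ, ∑ i ∈ Finset.Icc 1 1, f i = f 1 := by
    intro f; simp
  refine ⟨⟨hrange, ?_, ?_⟩, ?_⟩
  · intro k hk1 hk3 a ha
    rw [Finset.mem_Icc] at ha
    rw [h1, e4]
    have k1 := scan_count a _ (g1 a ha.1 ha.2)
    have k2 := scan_count a _ (g2 a ha.1 ha.2)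
    have k3 := scan_count a _ (g3 a ha.1 ha.2)
    simp [List.count_cons] at k1 k2 k3
    interval_cases k
    · simp only [e1]; simp [mkT, outer, inner']; omega
    · simp only [e2]; simp [mkT, outer, inner']; omega
    · simp only [e3]; simp [mkT, outer, inner']; omega
  · intro k hk1 hk3 i j i' j' hi1 hi4 hj1 hjk hi1' hi4' hj1' hjk' heq hlt
    obtain ⟨ha1, ha4⟩ := Finset.mem_Icc.1 (hrange i j k hi1 hi4 hj1 hjk hk3)
    clear h1 hrange e1 e2 e3 e4 m m'
    interval_cases k
    · have mem : ∀ i j, 1 ≤ i → i ≤ 4 → 1 ≤ j → j ≤ 1 → (Hc 3 i j 1, true, mkT (((c1, [d]), (c2, [x, y]), (c3, [p, q, s])),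
        ((c1', [d']), (c2', [x', y']), (c3', [p', q', s']))) i j 1) ∈
        ([(4, true, c1), (10, true, d), (16, true, d'), (22, true, c1')] : List (ℤ × Bool × ℕ)) := by
        intro i j h1 h2 h3 h4
        interval_cases i <;> interval_cases j <;> simp [Hc, mkT, outer, inner']
      have mem1 := mem i j hi1 hi4 hj1 hjk
      have mem2 := mem i' j' hi1' hi4' hj1' hjk'
      rw [← heq] at mem2
      obtain ⟨h, hm, hl1, hl2⟩ := scan_between _ _ (by simp) (g1 _ ha1 ha4) _ _ mem1 mem2 hlt
      generalize mkT (((c1, [d]), (c2, [x, y]), (c3, [p, q, s])),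
        ((c1', [d']), (c2', [x', y']), (c3', [p', q', s']))) i j 1 = a at hm ⊢
      simp only [List.mem_cons, List.not_mem_nil, or_false, Prod.mk.injEq, Bool.false_eq_true,
        false_and, and_false, false_or, true_and] at hm
    · have mem : ∀ i j, 1 ≤ i → i ≤ 4 → 1 ≤ j → j ≤ 2 → (Hc 3 i j 2, true, mkT (((c1, [d]), (c2, [x, y]), (c3, [p, q, s])),
        ((c1', [d']), (c2', [x', y']), (c3', [p', q', s']))) i j 2) ∈
        ([(3, true, c1), (4, false, c1), (5, true, c2), (9, true, x), (10, false, d), (11, true, y), (15, true, y'), (16, false, d'), (17, true, x'), (21, true, c2'), (22, false, c1'), (23, true, c1')] : List (ℤ × Bool × ℕ)) := by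
        intro i j h1 h2 h3 h4
        interval_cases i <;> interval_cases j <;> simp [Hc, mkT, outer, inner']
      have mem1 := mem i j hi1 hi4 hj1 hjk
      have mem2 := mem i' j' hi1' hi4' hj1' hjk'
      rw [← heq] at mem2
      obtain ⟨h, hm, hl1, hl2⟩ := scan_between _ _ (by simp) (g2 _ ha1 ha4) _ _ mem1 mem2 hlt
      generalize mkT (((c1, [d]), (c2, [x, y]), (c3, [p, q, s])),
        ((c1', [d']), (c2', [x', y']), (c3', [p', q', s']))) i j 2 = a at hm ⊢
      simp only [List.mem_cons, List.not_mem_nil, or_false, Prod.mk.injEq, Bool.false_eq_true,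
        false_and, and_false, false_or, true_and] at hm
      rcases hm with ⟨rfl, rfl⟩ | ⟨rfl, rfl⟩ | ⟨rfl, rfl⟩ | ⟨rfl, rfl⟩
      · exact ⟨1, 1, by norm_num, by norm_num, by norm_num, by norm_num,
          by simp [mkT, outer, inner'], lt_of_lt_of_eq hl1 (by simp [Hc]), lt_of_eq_of_lt (by simp [Hc]) hl2⟩
      · exact ⟨2, 1, by norm_num, by norm_num, by norm_num, by norm_num,
          by simp [mkT, outer, inner'], lt_of_lt_of_eq hl1 (by simp [Hc]), lt_of_eq_of_lt (by simp [Hc]) hl2⟩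
      · exact ⟨3, 1, by norm_num, by norm_num, by norm_num, by norm_num,
          by simp [mkT, outer, inner'], lt_of_lt_of_eq hl1 (by simp [Hc]), lt_of_eq_of_lt (by simp [Hc]) hl2⟩
      · exact ⟨4, 1, by norm_num, by norm_num, by norm_num, by norm_num,
          by simp [mkT, outer, inner'], lt_of_lt_of_eq hl1 (by simp [Hc]), lt_of_eq_of_lt (by simp [Hc]) hl2⟩
    · have mem : ∀ i j, 1 ≤ i → i ≤ 4 → 1 ≤ j → j ≤ 3 → (Hc 3 i j 3, true, mkT (((c1, [d]), (c2, [x, y]), (c3, [p, q, s])),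
        ((c1', [d']), (c2', [x', y']), (c3', [p', q', s']))) i j 3) ∈
        ([(2, true, c1), (3, false, c1), (4, true, c2), (5, false, c2), (6, true, c3), (8, true, p), (9, false, x), (10, true, q), (11, false, y), (12, true, s), (14, true, s'), (15, false, y'), (16, true, q'), (17, false, x'), (18, true, p'), (20, true, c3'), (21, false, c2'), (22, true, c2'), (23, false, c1'), (24, true, c1')] : List (ℤ × Bool × ℕ)) := by
        intro i j h1 h2 h3 h4
        interval_cases i <;> interval_cases j <;> simp [Hc, mkT, outer, inner']
      have mem1 := mem i j hi1 hi4 hj1 hjk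
      have mem2 := mem i' j' hi1' hi4' hj1' hjk'
      rw [← heq] at mem2
      obtain ⟨h, hm, hl1, hl2⟩ := scan_between _ _ (by simp) (g3 _ ha1 ha4) _ _ mem1 mem2 hlt
      generalize mkT (((c1, [d]), (c2, [x, y]), (c3, [p, q, s])),
        ((c1', [d']), (c2', [x', y']), (c3', [p', q', s']))) i j 3 = a at hm ⊢
      simp only [List.mem_cons, List.not_mem_nil, or_false, Prod.mk.injEq, Bool.false_eq_true,
        false_and, and_false, false_or, true_and] at hm
      rcases hm with ⟨rfl, rfl⟩ | ⟨rfl, rfl⟩ | ⟨rfl, rfl⟩ | ⟨rfl, rfl⟩ | ⟨rfl, rfl⟩ | ⟨rfl, rfl⟩ | ⟨rfl, rfl⟩ | ⟨rfl, rfl⟩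
      · exact ⟨1, 1, by norm_num, by norm_num, by norm_num, by norm_num,
          by simp [mkT, outer, inner'], lt_of_lt_of_eq hl1 (by simp [Hc]), lt_of_eq_of_lt (by simp [Hc]) hl2⟩
      · exact ⟨1, 2, by norm_num, by norm_num, by norm_num, by norm_num,
          by simp [mkT, outer, inner'], lt_of_lt_of_eq hl1 (by simp [Hc]), lt_of_eq_of_lt (by simp [Hc]) hl2⟩
      · exact ⟨2, 1, by norm_num, by norm_num, by norm_num, by norm_num,
          by simp [mkT, outer, inner'], lt_of_lt_of_eq hl1 (by simp [Hc]), lt_of_eq_of_lt (by simp [Hc]) hl2⟩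
      · exact ⟨2, 2, by norm_num, by norm_num, by norm_num, by norm_num,
          by simp [mkT, outer, inner'], lt_of_lt_of_eq hl1 (by simp [Hc]), lt_of_eq_of_lt (by simp [Hc]) hl2⟩
      · exact ⟨3, 1, by norm_num, by norm_num, by norm_num, by norm_num,
          by simp [mkT, outer, inner'], lt_of_lt_of_eq hl1 (by simp [Hc]), lt_of_eq_of_lt (by simp [Hc]) hl2⟩
      · exact ⟨3, 2, by norm_num, by norm_num, by norm_num, by norm_num,
          by simp [mkT, outer, inner'], lt_of_lt_of_eq hl1 (by simp [Hc]), lt_of_eq_of_lt (by simp [Hc]) hl2⟩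
      · exact ⟨4, 1, by norm_num, by norm_num, by norm_num, by norm_num,
          by simp [mkT, outer, inner'], lt_of_lt_of_eq hl1 (by simp [Hc]), lt_of_eq_of_lt (by simp [Hc]) hl2⟩
      · exact ⟨4, 2, by norm_num, by norm_num, by norm_num, by norm_num,
          by simp [mkT, outer, inner'], lt_of_lt_of_eq hl1 (by simp [Hc]), lt_of_eq_of_lt (by simp [Hc]) hl2⟩
  · intro i j k h
    simp [mkT, h]

theorem mkT_inj : Set.InjOn mkT {t | t ∈ pairsList} := by
  rintro ⟨l, r⟩ ht ⟨l2, r2⟩ ht2 h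
  obtain ⟨_, -, _, -, _, -, hl, hr⟩ := pairs_mem.1 ht
  obtain ⟨_, -, _, -, _, -, hl2, hr2⟩ := pairs_mem.1 ht2
  obtain ⟨c1, d, c2, x, y, c3, p, q, s, rfl, -⟩ := halves_spec hl
  obtain ⟨c1', d', c2', x', y', c3', p', q', s', rfl, -⟩ := halves_spec hr
  obtain ⟨b1, e, b2, u, v, b3, f, g, w, rfl, -⟩ := halves_spec hl2
  obtain ⟨b1', e', b2', u', v', b3', f', g', w', rfl, -⟩ := halves_spec hr2
  clear hl hr hl2 hr2 ht ht2
  have H : ∀ i j k, mkT _ i j k = mkT _ i j k := fun i j k => congrFun (congrFun (congrFun h i) j) k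
  have H0 := H 1 1 3
  have H1 := H 1 2 3
  have H2 := H 1 3 3
  have H3 := H 4 1 3
  have H4 := H 4 2 3
  have H5 := H 4 3 3
  have H6 := H 2 1 1
  have H7 := H 2 1 2
  have H8 := H 2 2 2
  have H9 := H 2 1 3
  have H10 := H 2 2 3
  have H11 := H 2 3 3
  have H12 := H 3 1 1
  have H13 := H 3 1 2
  have H14 := H 3 2 2
  have H15 := H 3 1 3
  have H16 := H 3 2 3
  have H17 := H 3 3 3
  clear H h
  simp [mkT, outer, inner'] at H0 H1 H2 H3 H4 H5 H6 H7 H8 H9 H10 H11 H12 H13 H14 H15 H16 H17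
  simp only [H0, H1, H2, H3, H4, H5, H6, H7, H8, H9, H10, H11, H12, H13, H14, H15, H16, H17]

theorem ita_finite : (ITAFull 4 3).Finite := by
  refine Set.Finite.of_injOn (t := Set.univ)
    (f := fun (T : ℕ → ℕ → ℕ → ℕ) (i : Fin 5) (j k : Fin 4) => (Fin.ofNat 5 (T i j k) : Fin 5))
    (fun _ _ => Set.mem_univ _) ?_ Set.finite_univ
  rintro T ⟨⟨hT, -⟩, hT0⟩ U ⟨⟨hU, -⟩, hU0⟩ h
  funext i j k
  by_cases hc : 1 ≤ i ∧ i ≤ 4 ∧ 1 ≤ j ∧ j ≤ k ∧ k ≤ 3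
  · have h1 := congrFun (congrFun (congrFun h ⟨i, by omega⟩) ⟨j, by omega⟩) ⟨k, by omega⟩
    obtain ⟨c1, c2, c3, c4, c5⟩ := hc
    have h2 := Finset.mem_Icc.1 (hT i j k c1 c2 c3 c4 c5)
    have h3 := Finset.mem_Icc.1 (hU i j k c1 c2 c3 c4 c5)
    have h4 := congrArg Fin.val h1
    simp only [Fin.val_ofNat] at h4
    omega
  · rw [hT0 i j k hc, hU0 i j k hc]

theorem ita_ge : 191232 ≤ (ITAFull 4 3).ncard := by
  classical
  have h := Set.ncard_le_ncard_of_injOn (s := ((pairsList.toFinset : Finset (HalfData × HalfData)) :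
    Set (HalfData × HalfData))) mkT (fun t ht => mkT_mem (by simpa using ht))
    (fun a ha b hb hab => mkT_inj (by simpa using ha) (by simpa using hb) hab) ita_finite
  rw [Set.ncard_coe_finset, List.toFinset_card_of_nodup pairs_nodup, pairs_length] at h
  exact h

/-- There is a positive integer `n` for which `5` times the number of interlacing
triangular arrays of rank `4` and height `n` differs from the number of proper vertex
`5`-colorings of `⊠_n` (disproving Conjecture A.5 of Aggarwal–Borodin–Wheeler). -/
theorem conjecture_A5_false :
    ∃ n : ℕ, 1 ≤ n ∧ 5 * (ITAFull 4 n).ncard ≠ (BoxColorFull n).ncard := by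
  have h1 := box_le
  have h2 := ita_ge
  exact ⟨3, by norm_num, by omega⟩
end
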